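/- arXiv:2601.21620 — 2 statements merged into one kernel-verified Lean document; each statement's English description precedes it below -/
import Mathlib

section
/- Let d ≥ 1, 1 ≤ q ≤ 2, and let p satisfy either q ≤ p ≤ q′ or p < min(q, q′). Let α > 0 and β > 0 satisfy the conditions: either (p ≤ q < ∞ and β = d(1 − 1/q − 1/p)) or β > d(1 − 1/q − 1/p), and if p > 2 additionally β > d(1/2 − 1/p). Set θ = (β + d(1/p + 1/q − 1)) / (α + β + d(1/p + 1/q − 1)). Then there is a constant C such that for every invertible linear operator T on L^2(ℝ^d) with T^{−1} = T^* and ‖Tg‖_∞ ≤ ‖g‖_1 for all g ∈ L^1(ℝ^d) ∩ L^2(ℝ^d) and ‖Tg‖_2 ≤ ‖g‖_2 for all g ∈ L^2(ℝ^d), and every f: ‖Tf‖_q ≤ C ‖ |x|^α Tf ‖_q^θ ‖ |ξ|^β f ‖_p^{1−θ}. -/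
open MeasureTheory
open scoped ENNReal

section Operator

variable {X : Type*} [MeasurableSpace X] {μ : Measure X}

lemma eLpNorm_le_eLpNorm_top_rpow_mul_eLpNorm_two_rpow {f : X → ℂ}
    (hf : AEStronglyMeasurable f μ) {r : ℝ≥0∞} (hr : 2 ≤ r) :
    eLpNorm f r μ ≤
      eLpNorm f ∞ μ ^ (1 - 2 * r.toReal⁻¹) * eLpNorm f 2 μ ^ (2 * r.toReal⁻¹) := by
  rcases eq_or_ne r ∞ with rfl | hr_top
  · simp
  have hr' : (2 : ℝ) ≤ r.toReal := by simpa using ENNReal.toReal_mono hr_top hr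
  have hr0 : r ≠ 0 := (zero_lt_two.trans_le hr).ne'
  have hpos : 0 < r.toReal := by linarith
  rw [eLpNorm_eq_lintegral_rpow_enorm_toReal hr0 hr_top,
    eLpNorm_eq_lintegral_rpow_enorm_toReal two_ne_zero ENNReal.ofNat_ne_top]
  have key : ∫⁻ x, ‖f x‖ₑ ^ r.toReal ∂μ ≤
      eLpNorm f ∞ μ ^ (r.toReal - 2) * ∫⁻ x, ‖f x‖ₑ ^ (2 : ℝ) ∂μ := by
    rw [← lintegral_const_mul'' _ (hf.enorm.pow_const _)]
    refine lintegral_mono_ae ?_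
    filter_upwards [enorm_ae_le_eLpNormEssSup f μ] with x hx
    calc ‖f x‖ₑ ^ r.toReal = ‖f x‖ₑ ^ (r.toReal - 2) * ‖f x‖ₑ ^ (2 : ℝ) := by
          rw [← ENNReal.rpow_add_of_nonneg _ _ (by linarith) (by norm_num)]; simp
      _ ≤ _ := by
          gcongr
          simpa using hx
  calc (∫⁻ x, ‖f x‖ₑ ^ r.toReal ∂μ) ^ (1 / r.toReal)
      ≤ (eLpNorm f ∞ μ ^ (r.toReal - 2) * ∫⁻ x, ‖f x‖ₑ ^ (2 : ℝ) ∂μ) ^ (1 / r.toReal) := by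
        gcongr
    _ = _ := by
        rw [ENNReal.mul_rpow_of_nonneg _ _ (by positivity), ← ENNReal.rpow_mul,
          ← ENNReal.rpow_mul]
        congr 2
        · field_simp
        · simp

lemma enorm_inner_le_eLpNorm_mul_eLpNorm (f g : Lp ℂ 2 μ) (p r : ℝ≥0∞)
    [ENNReal.HolderConjugate p r] :
    ‖inner ℂ f g‖ₑ ≤ eLpNorm f p μ * eLpNorm g r μ := by
  rw [L2.inner_def]
  calc ‖∫ x, inner ℂ (f x) (g x) ∂μ‖ₑ ≤ eLpNorm (fun x => inner ℂ (f x) (g x)) 1 μ := by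
        rw [eLpNorm_one_eq_lintegral_enorm]
        exact enorm_integral_le_lintegral_enorm _
    _ ≤ (1 : NNReal) * eLpNorm f p μ * eLpNorm g r μ :=
        eLpNorm_le_eLpNorm_mul_eLpNorm'_of_norm (Lp.aestronglyMeasurable f)
          (Lp.aestronglyMeasurable g) _ 1
          (Filter.Eventually.of_forall fun x => by
            simpa using norm_inner_le_norm (𝕜 := ℂ) (f x) (g x))
    _ = _ := by simp

lemma exists_inner_eq_setIntegral_norm (g : Lp ℂ 2 μ) {s : Set X} (hs : MeasurableSet s)
    (hμs : μ s ≠ ∞) :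
    ∃ φ : Lp ℂ 2 μ, eLpNorm φ 1 μ ≤ μ s ∧ inner ℂ φ g = ((∫ x in s, ‖g x‖ ∂μ : ℝ) : ℂ) := by
  have : IsFiniteMeasure (μ.restrict s) := isFiniteMeasure_restrict.2 hμs
  set u : X → ℂ := s.indicator fun x => g x * ((‖g x‖⁻¹ : ℝ) : ℂ) with hu
  have hbound : ∀ x, ‖g x * ((‖g x‖⁻¹ : ℝ) : ℂ)‖ ≤ 1 := fun x => by
    rw [norm_mul, Complex.norm_real, Real.norm_of_nonneg (by positivity)]
    exact mul_inv_le_one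
  have hu2 : MemLp u 2 μ := by
    rw [hu, memLp_indicator_iff_restrict hs]
    refine MemLp.of_bound ?_ 1 (Filter.Eventually.of_forall hbound)
    have := (Lp.stronglyMeasurable g).measurable
    exact (by fun_prop : Measurable fun x => g x * ((‖g x‖⁻¹ : ℝ) : ℂ)).aestronglyMeasurable
  refine ⟨hu2.toLp u, ?_, ?_⟩
  · rw [eLpNorm_congr_ae hu2.coeFn_toLp, hu, eLpNorm_indicator_eq_eLpNorm_restrict hs]
    simpa using eLpNorm_le_of_ae_bound (p := 1) (Filter.Eventually.of_forall hbound)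
      (μ := μ.restrict s)
  · rw [L2.inner_def, ← integral_complex_ofReal, ← integral_indicator hs]
    refine integral_congr_ae ?_
    filter_upwards [hu2.coeFn_toLp] with x hx
    rw [hx, hu]
    by_cases hxs : x ∈ s
    · simp only [Set.indicator_of_mem hxs, RCLike.inner_apply, map_mul, Complex.conj_ofReal]
      rw [← mul_assoc, RCLike.mul_conj]
      rcases eq_or_ne (g x) 0 with h0 | h0
      · simp [h0]
      · have : ((‖g x‖ : ℝ) : ℂ) ≠ 0 := by simpa using h0
        push_cast
        field_simp
        rfl
    · simp [Set.indicator_of_notMem hxs]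

lemma eLpNorm_top_adjoint_le [SigmaFinite μ] (T : Lp ℂ 2 μ →L[ℂ] Lp ℂ 2 μ)
    (hT : ∀ g : Lp ℂ 2 μ, eLpNorm g 1 μ < ∞ → eLpNorm (T g) ∞ μ ≤ eLpNorm g 1 μ)
    (g : Lp ℂ 2 μ) :
    eLpNorm (ContinuousLinearMap.adjoint T g) ∞ μ ≤ eLpNorm g 1 μ := by
  set h := ContinuousLinearMap.adjoint T g
  rw [eLpNorm_exponent_top]
  refine essSup_le_of_ae_le _ ?_
  refine ae_le_of_forall_setLIntegral_le_of_sigmaFinite₀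
    (Lp.aestronglyMeasurable h).enorm fun s hs hμs => ?_
  obtain ⟨φ, hφ1, hφ⟩ := exists_inner_eq_setIntegral_norm h hs hμs.ne
  have : Fact (μ s < ∞) := ⟨hμs⟩
  have hint : Integrable h (μ.restrict s) :=
    ((Lp.memLp h).restrict s).integrable one_le_two
  calc ∫⁻ x in s, ‖h x‖ₑ ∂μ = ‖inner ℂ φ h‖ₑ := by
        rw [hφ, ← ofReal_integral_norm_eq_lintegral_enorm hint, ← ofReal_norm, Complex.norm_real,
          Real.norm_of_nonneg (integral_nonneg fun _ => norm_nonneg _)]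
    _ = ‖inner ℂ (T φ) g‖ₑ := by rw [ContinuousLinearMap.adjoint_inner_right]
    _ ≤ eLpNorm (T φ) ∞ μ * eLpNorm g 1 μ := enorm_inner_le_eLpNorm_mul_eLpNorm _ _ _ _
    _ ≤ μ s * eLpNorm g 1 μ := by
        gcongr
        exact (hT φ (hφ1.trans_lt hμs)).trans hφ1
    _ = ∫⁻ x in s, eLpNorm g 1 μ ∂μ := by simp [mul_comm]

lemma eLpNorm_two_restrict_le (T : Lp ℂ 2 μ →L[ℂ] Lp ℂ 2 μ)
    (hT₁ : ∀ g : Lp ℂ 2 μ, eLpNorm g 1 μ < ∞ →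
      eLpNorm (ContinuousLinearMap.adjoint T g) ∞ μ ≤ eLpNorm g 1 μ)
    (hT₂ : ∀ g : Lp ℂ 2 μ, ‖ContinuousLinearMap.adjoint T g‖ ≤ ‖g‖)
    (f : Lp ℂ 2 μ) {p : ℝ≥0∞} (hp : 1 ≤ p) (hp2 : p ≤ 2)
    {s : Set X} (hs : MeasurableSet s) (hμs : μ s ≠ ∞) :
    eLpNorm (T f) 2 (μ.restrict s) ≤ μ s ^ (p.toReal⁻¹ - 1 / 2) * eLpNorm f p μ := by
  have hψ : MemLp (s.indicator (T f)) 2 μ := (Lp.memLp (T f)).indicator hs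
  set ψ : Lp ℂ 2 μ := hψ.toLp _
  have hψnorm (r : ℝ≥0∞) : eLpNorm ψ r μ = eLpNorm (T f) r (μ.restrict s) := by
    rw [eLpNorm_congr_ae hψ.coeFn_toLp, eLpNorm_indicator_eq_eLpNorm_restrict hs]
  set N := eLpNorm (T f) 2 (μ.restrict s)
  have hψ2 : eLpNorm ψ 2 μ = N := hψnorm 2
  have hN : N ≠ ∞ := by rw [← hψ2]; exact Lp.eLpNorm_ne_top ψ
  rcases eq_or_ne N 0 with hN0 | hN0
  · simp [hN0]
  have hp_top : p ≠ ∞ := (hp2.trans_lt (by simp)).ne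
  have hp1' : 1 ≤ p.toReal := by simpa using ENNReal.toReal_mono hp_top hp
  have hp2' : p.toReal ≤ 2 := by simpa using ENNReal.toReal_mono (by simp) hp2
  obtain ⟨r, hpr⟩ : ∃ r, ENNReal.HolderConjugate p r := ⟨_, .conjExponent hp⟩
  have hr2 : 2 ≤ r := by
    have h1 := hpr.inv_add_inv_eq_inv
    have h2 : (2 : ℝ≥0∞)⁻¹ ≤ p⁻¹ := ENNReal.inv_le_inv.2 hp2
    rw [← ENNReal.inv_le_inv]
    have h3 : (2 : ℝ≥0∞)⁻¹ + r⁻¹ ≤ 2⁻¹ + 2⁻¹ := by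
      rw [ENNReal.inv_two_add_inv_two]
      calc _ ≤ p⁻¹ + r⁻¹ := by gcongr
        _ = 1 := by simpa using h1
    exact (ENNReal.add_le_add_iff_left (by simp)).1 h3
  have hrinv : r.toReal⁻¹ = 1 - p.toReal⁻¹ := by
    have h1 := congrArg ENNReal.toReal hpr.inv_add_inv_eq_inv
    rw [ENNReal.toReal_add (by simp; positivity) (by simp; positivity)] at h1
    simp at h1
    linarith
  have he : 0 ≤ 1 - 2 * r.toReal⁻¹ := by
    rw [hrinv]
    have : (2 : ℝ)⁻¹ ≤ p.toReal⁻¹ := by gcongr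
    linarith
  have hψ1 : eLpNorm ψ 1 μ ≤ μ s ^ (1 / 2 : ℝ) * N := by
    rw [hψnorm, mul_comm]
    refine (eLpNorm_le_eLpNorm_mul_rpow_measure_univ one_le_two
      (Lp.aestronglyMeasurable (T f)).restrict).trans_eq ?_
    norm_num [N]
  have hsq : N ^ (2 : ℝ) ≤ μ s ^ (p.toReal⁻¹ - 1 / 2) * eLpNorm f p μ * N := by
    calc N ^ (2 : ℝ) = ‖inner ℂ ψ (T f)‖ₑ := by
          have h1 : inner ℂ ψ (T f) = inner ℂ ψ ψ := by
            rw [L2.inner_def, L2.inner_def]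
            refine integral_congr_ae ?_
            filter_upwards [hψ.coeFn_toLp] with x hx
            rw [hx]
            by_cases hxs : x ∈ s <;> simp [hxs]
          rw [h1, inner_self_eq_norm_sq_to_K, enorm_pow, ← hψ2]
          rw [← Lp.enorm_def, ← ofReal_norm, ← ofReal_norm]
          simp
      _ = ‖inner ℂ f (ContinuousLinearMap.adjoint T ψ)‖ₑ := by
          rw [ContinuousLinearMap.adjoint_inner_right, ← inner_conj_symm, RCLike.enorm_conj]
      _ ≤ eLpNorm f p μ * eLpNorm (ContinuousLinearMap.adjoint T ψ) r μ :=
          enorm_inner_le_eLpNorm_mul_eLpNorm _ _ _ _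
      _ ≤ eLpNorm f p μ * ((μ s ^ (1 / 2 : ℝ) * N) ^ (1 - 2 * r.toReal⁻¹) *
            N ^ (2 * r.toReal⁻¹)) := by
          gcongr
          refine (eLpNorm_le_eLpNorm_top_rpow_mul_eLpNorm_two_rpow
            (Lp.aestronglyMeasurable _) hr2).trans ?_
          gcongr
          · refine (hT₁ ψ (hψ1.trans_lt ?_)).trans hψ1
            finiteness
          · rw [← hψ2, ← Lp.enorm_def, ← Lp.enorm_def, ← ofReal_norm, ← ofReal_norm]
            exact ENNReal.ofReal_le_ofReal (hT₂ ψ)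
      _ = _ := by
          rw [ENNReal.mul_rpow_of_nonneg _ _ he, mul_assoc, ← ENNReal.rpow_add _ _ hN0 hN,
            ← ENNReal.rpow_mul, hrinv]
          ring_nf
          simp
  rw [ENNReal.rpow_two, sq] at hsq
  exact (ENNReal.mul_le_mul_iff_left hN0 hN).1 hsq

lemma toReal_inv_sub_half_nonneg {q : ℝ≥0∞} (hq : 1 ≤ q) (hq2 : q ≤ 2) :
    0 ≤ q.toReal⁻¹ - 1 / 2 := by
  have hq_top : q ≠ ∞ := (hq2.trans_lt (by simp)).ne
  have hq1' : 1 ≤ q.toReal := by simpa using ENNReal.toReal_mono hq_top hq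
  have hq2' : q.toReal ≤ 2 := by simpa using ENNReal.toReal_mono (by simp) hq2
  have : (2 : ℝ)⁻¹ ≤ q.toReal⁻¹ := by gcongr
  linarith

lemma eLpNorm_restrict_le_add [SigmaFinite μ] (T : Lp ℂ 2 μ →L[ℂ] Lp ℂ 2 μ)
    (hleft : (ContinuousLinearMap.adjoint T).comp T = ContinuousLinearMap.id ℂ _)
    (hT₁ : ∀ g : Lp ℂ 2 μ, eLpNorm g 1 μ < ∞ → eLpNorm (T g) ∞ μ ≤ eLpNorm g 1 μ)
    (hT₂ : ∀ g : Lp ℂ 2 μ, ‖T g‖ ≤ ‖g‖)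
    (f : Lp ℂ 2 μ) {q r : ℝ≥0∞} (hq : 1 ≤ q) (hq2 : q ≤ 2) (hr : 1 ≤ r) (hr2 : r ≤ 2)
    {s t : Set X} (hs : MeasurableSet s) (hμs : μ s ≠ ∞) (ht : MeasurableSet t)
    (hμt : μ t ≠ ∞) :
    eLpNorm (T f) q (μ.restrict s) ≤ (μ s * μ t) ^ q.toReal⁻¹ * eLpNorm (T f) q μ +
      μ s ^ (q.toReal⁻¹ + r.toReal⁻¹ - 1) * eLpNorm f r (μ.restrict tᶜ) := by
  have hq0 := toReal_inv_sub_half_nonneg hq hq2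
  have hr0 := toReal_inv_sub_half_nonneg hr hr2
  have hT₂' : ∀ g, ‖ContinuousLinearMap.adjoint T g‖ ≤ ‖g‖ := by
    have hnorm : ‖T‖ ≤ 1 := T.opNorm_le_bound zero_le_one (by simpa using hT₂)
    intro g
    simpa using (ContinuousLinearMap.adjoint T).le_of_opNorm_le
      ((LinearIsometryEquiv.norm_map _ T).trans_le hnorm) g
  have h₁ : MemLp (t.indicator f) 2 μ := (Lp.memLp f).indicator ht
  have h₂ : MemLp (tᶜ.indicator f) 2 μ := (Lp.memLp f).indicator ht.compl
  have hsum : f = h₁.toLp _ + h₂.toLp _ := by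
    rw [← MemLp.toLp_add]
    simp only [Set.indicator_self_add_compl]
    exact (Lp.toLp_coeFn f (Lp.memLp f)).symm
  have hbound (g : Lp ℂ 2 μ) {p : ℝ≥0∞} (hp : 1 ≤ p) (hp2 : p ≤ 2) :
      eLpNorm (T g) 2 (μ.restrict s) ≤ μ s ^ (p.toReal⁻¹ - 1 / 2) * eLpNorm g p μ :=
    eLpNorm_two_restrict_le T (fun g _ => eLpNorm_top_adjoint_le T hT₁ g) hT₂' g hp hp2 hs hμs
  have hlow : eLpNorm (h₁.toLp _) 1 μ ≤ μ t ^ q.toReal⁻¹ * eLpNorm (T f) q μ := by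
    rw [eLpNorm_congr_ae h₁.coeFn_toLp, eLpNorm_indicator_eq_eLpNorm_restrict ht]
    have h := eLpNorm_two_restrict_le (ContinuousLinearMap.adjoint T)
      (by simpa using hT₁) (by simpa using hT₂) (T f) hq hq2 ht hμt
    have hf : ContinuousLinearMap.adjoint T (T f) = f := by
      simpa using congrArg (fun S => S f) hleft
    rw [hf] at h
    calc eLpNorm f 1 (μ.restrict t)
        ≤ eLpNorm f 2 (μ.restrict t) * μ t ^ (1 / 2 : ℝ) := by
          refine (eLpNorm_le_eLpNorm_mul_rpow_measure_univ one_le_two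
            (Lp.aestronglyMeasurable f).restrict).trans_eq ?_
          norm_num
      _ ≤ μ t ^ (q.toReal⁻¹ - 1 / 2) * eLpNorm (T f) q μ * μ t ^ (1 / 2 : ℝ) := by gcongr
      _ = _ := by
          rw [mul_right_comm, ← ENNReal.rpow_add_of_nonneg _ _ hq0 (by norm_num),
            sub_add_cancel]
  calc eLpNorm (T f) q (μ.restrict s)
      ≤ eLpNorm (T f) 2 (μ.restrict s) * μ s ^ (q.toReal⁻¹ - 1 / 2) := by
        simpa using eLpNorm_le_eLpNorm_mul_rpow_measure_univ hq2
            (Lp.aestronglyMeasurable (T f)).restrict (μ := μ.restrict s)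
    _ ≤ (eLpNorm (T (h₁.toLp _)) 2 (μ.restrict s) + eLpNorm (T (h₂.toLp _)) 2 (μ.restrict s)) *
          μ s ^ (q.toReal⁻¹ - 1 / 2) := by
        gcongr
        have hae : T f =ᵐ[μ.restrict s] T (h₁.toLp _) + T (h₂.toLp _) := by
          conv_lhs => rw [hsum, map_add]
          exact ae_restrict_of_ae (Lp.coeFn_add _ _)
        rw [eLpNorm_congr_ae hae]
        exact eLpNorm_add_le (Lp.aestronglyMeasurable _).restrict
          (Lp.aestronglyMeasurable _).restrict one_le_two
    _ ≤ (μ s ^ (1 / 2 : ℝ) * (μ t ^ q.toReal⁻¹ * eLpNorm (T f) q μ) +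
          μ s ^ (r.toReal⁻¹ - 1 / 2) * eLpNorm f r (μ.restrict tᶜ)) *
          μ s ^ (q.toReal⁻¹ - 1 / 2) := by
        gcongr
        · refine (hbound _ le_rfl one_le_two).trans ?_
          norm_num
          gcongr
        · refine (hbound _ hr hr2).trans_eq ?_
          rw [eLpNorm_congr_ae h₂.coeFn_toLp, eLpNorm_indicator_eq_eLpNorm_restrict ht.compl]
    _ = _ := by
        have e₁ : q.toReal⁻¹ = 1 / 2 + (q.toReal⁻¹ - 1 / 2) := by ring
        have e₂ : q.toReal⁻¹ + r.toReal⁻¹ - 1 = (r.toReal⁻¹ - 1 / 2) + (q.toReal⁻¹ - 1 / 2) := by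
          ring
        have e₃ : μ s ^ q.toReal⁻¹ = μ s ^ (1 / 2 : ℝ) * μ s ^ (q.toReal⁻¹ - 1 / 2) := by
          rw [← ENNReal.rpow_add_of_nonneg _ _ (by norm_num) hq0, ← e₁]
        rw [e₂, ENNReal.rpow_add_of_nonneg _ _ hr0 hq0,
          ENNReal.mul_rpow_of_nonneg _ _ (by positivity), e₃]
        ring

end Operator

lemma eLpNorm_compl_ball_le_rpow_neg_mul {E : Type*} [NormedAddCommGroup E] [MeasurableSpace E]
    [BorelSpace E] (μ : Measure E) {β : ℝ} (hβ : 0 ≤ β) (p : ℝ≥0∞) (f : E → ℂ) {l : ℝ}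
    (hl : 0 < l) :
    eLpNorm f p (μ.restrict (Metric.ball 0 l)ᶜ) ≤
      ENNReal.ofReal (l ^ (-β)) * eLpNorm (fun x => ‖x‖ ^ β * ‖f x‖) p μ := by
  refine (eLpNorm_le_mul_eLpNorm_of_ae_le_mul (c := l ^ (-β))
    (g := fun x => ‖x‖ ^ β * ‖f x‖) ?_ p).trans ?_
  · refine ae_restrict_of_forall_mem Metric.isOpen_ball.measurableSet.compl fun x hx => ?_
    have hx' : l ≤ ‖x‖ := by simpa using hx
    rw [Real.norm_of_nonneg (by positivity), ← mul_assoc]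
    refine le_mul_of_one_le_left (norm_nonneg _) ?_
    rw [Real.rpow_neg hl.le, inv_mul_eq_div, one_le_div (by positivity)]
    gcongr
  · gcongr
    exact Measure.restrict_le_self

section Weight

variable {E : Type*} [NormedAddCommGroup E] [NormedSpace ℝ E] [FiniteDimensional ℝ E]
  [MeasurableSpace E] [BorelSpace E] (μ : Measure E) [μ.IsAddHaarMeasure]

lemma eLpNorm_one_add_norm_rpow_lt_top {β : ℝ} {s : ℝ≥0∞} (hs0 : s ≠ 0) (hs : s ≠ ∞)
    (hβs : (Module.finrank ℝ E : ℝ) < β * s.toReal) :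
    eLpNorm (fun x : E => (1 + ‖x‖) ^ (-β)) s μ < ∞ := by
  rw [eLpNorm_lt_top_iff_lintegral_rpow_enorm_lt_top hs0 hs]
  convert finite_integral_one_add_norm (μ := μ) hβs using 3 with x
  rw [Real.enorm_of_nonneg (by positivity), ENNReal.ofReal_rpow_of_nonneg (by positivity)
    (by positivity), ← Real.rpow_mul (by positivity), neg_mul]

lemma eLpNorm_comp_inv_smul {F : Type*} [NormedAddCommGroup F] {u : E → F} (hu : Continuous u)
    [SecondCountableTopologyEither E F] {s : ℝ≥0∞} (hs : s ≠ ∞) {l : ℝ} (hl : 0 < l) :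
    eLpNorm (fun x => u (l⁻¹ • x)) s μ =
      ENNReal.ofReal (l ^ ((Module.finrank ℝ E : ℝ) * s.toReal⁻¹)) * eLpNorm u s μ := by
  have h := eLpNorm_map_measure (p := s) (μ := μ) (f := fun x : E => l⁻¹ • x) (g := u)
    hu.aestronglyMeasurable (by fun_prop)
  rw [Measure.map_addHaar_smul μ (inv_ne_zero hl.ne'), eLpNorm_smul_measure_of_ne_top hs] at h
  rw [Function.comp_def] at h
  rw [← h, smul_eq_mul]
  congr 1
  rw [inv_pow, inv_inv, abs_of_pos (by positivity), ENNReal.ofReal_rpow_of_nonneg (by positivity)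
    (by positivity), ← Real.rpow_natCast, ← Real.rpow_mul hl.le]
  simp

lemma exists_eLpNorm_norm_rpow_compl_ball_le {β : ℝ} (hβ : 0 ≤ β) {s : ℝ≥0∞} (hs0 : s ≠ 0)
    (hs : s ≠ ∞) (hβs : (Module.finrank ℝ E : ℝ) < β * s.toReal) :
    ∃ K : ℝ≥0∞, K ≠ ∞ ∧ ∀ l : ℝ, 0 < l →
      eLpNorm (fun x : E => ‖x‖ ^ (-β)) s (μ.restrict (Metric.ball 0 l)ᶜ) ≤
        K * ENNReal.ofReal (l ^ (-β + (Module.finrank ℝ E : ℝ) * s.toReal⁻¹)) := by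
  refine ⟨ENNReal.ofReal (2 ^ β) * eLpNorm (fun x : E => (1 + ‖x‖) ^ (-β)) s μ,
    ENNReal.mul_ne_top ENNReal.ofReal_ne_top
      (eLpNorm_one_add_norm_rpow_lt_top μ hs0 hs hβs).ne, fun l hl => ?_⟩
  have hpt : ∀ᵐ x ∂μ.restrict (Metric.ball (0 : E) l)ᶜ,
      ‖‖x‖ ^ (-β)‖ ≤ (2 ^ β * l ^ (-β)) * ‖(1 + ‖l⁻¹ • x‖) ^ (-β)‖ := by
    refine ae_restrict_of_forall_mem Metric.isOpen_ball.measurableSet.compl fun x hx => ?_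
    have hx' : l ≤ ‖x‖ := by simpa using hx
    have hxpos : 0 < ‖x‖ := hl.trans_le hx'
    rw [Real.norm_of_nonneg (by positivity), Real.norm_of_nonneg (by positivity), norm_smul,
      norm_inv, Real.norm_of_nonneg hl.le]
    have h2 : (2 : ℝ) ^ β = (2⁻¹ : ℝ) ^ (-β) := by
      rw [Real.inv_rpow zero_le_two, Real.rpow_neg zero_le_two, inv_inv]
    rw [h2, ← Real.mul_rpow (by positivity) hl.le, ← Real.mul_rpow (by positivity) (by positivity)]
    refine Real.rpow_le_rpow_of_nonpos (by positivity) ?_ (by linarith)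
    field_simp
    linarith
  calc eLpNorm (fun x : E => ‖x‖ ^ (-β)) s (μ.restrict (Metric.ball 0 l)ᶜ)
      ≤ ENNReal.ofReal (2 ^ β * l ^ (-β)) *
          eLpNorm (fun x : E => (1 + ‖l⁻¹ • x‖) ^ (-β)) s (μ.restrict (Metric.ball 0 l)ᶜ) :=
        eLpNorm_le_mul_eLpNorm_of_ae_le_mul hpt s
    _ ≤ ENNReal.ofReal (2 ^ β * l ^ (-β)) *
          eLpNorm (fun x : E => (1 + ‖l⁻¹ • x‖) ^ (-β)) s μ := by
        gcongr
        exact Measure.restrict_le_self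
    _ = _ := by
        have hc : Continuous fun x : E => (1 + ‖x‖) ^ (-β) :=
          (by fun_prop : Continuous fun x : E => 1 + ‖x‖).rpow_const
            fun x => Or.inl (by positivity)
        rw [eLpNorm_comp_inv_smul μ hc hs hl, ENNReal.ofReal_mul (by positivity),
          Real.rpow_add hl, ENNReal.ofReal_mul (by positivity)]
        ring

lemma exists_eLpNorm_compl_ball_le {β : ℝ} (hβ : 0 ≤ β) {p r : ℝ≥0∞} (hr : r ≠ 0) (hrp : r ≤ p)
    (hβr : r < p → (Module.finrank ℝ E : ℝ) * (r.toReal⁻¹ - p.toReal⁻¹) < β) :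
    ∃ K : ℝ≥0∞, K ≠ ∞ ∧ ∀ f : E → ℂ, AEStronglyMeasurable f μ → ∀ l : ℝ, 0 < l →
      eLpNorm f r (μ.restrict (Metric.ball 0 l)ᶜ) ≤
        K * ENNReal.ofReal (l ^ (-β + (Module.finrank ℝ E : ℝ) * (r.toReal⁻¹ - p.toReal⁻¹))) *
          eLpNorm (fun x => ‖x‖ ^ β * ‖f x‖) p μ := by
  rcases hrp.eq_or_lt with rfl | hlt
  · refine ⟨1, ENNReal.one_ne_top, fun f _ l hl => ?_⟩
    rw [sub_self, mul_zero, add_zero, one_mul]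
    exact eLpNorm_compl_ball_le_rpow_neg_mul μ hβ r f hl
  · have hr_top : r ≠ ∞ := hlt.ne_top
    have hp0 : p ≠ 0 := (bot_le.trans_lt hlt).ne'
    have hinv : p⁻¹ < r⁻¹ := ENNReal.inv_lt_inv.2 hlt
    set s : ℝ≥0∞ := (r⁻¹ - p⁻¹)⁻¹ with hs
    have hs0 : s ≠ 0 := by
      rw [hs, ENNReal.inv_ne_zero]
      exact ENNReal.sub_ne_top (by simpa using hr)
    have hs_top : s ≠ ∞ := by
      rw [hs, ENNReal.inv_ne_top]
      exact (tsub_pos_of_lt hinv).ne'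
    have hs_inv : s.toReal⁻¹ = r.toReal⁻¹ - p.toReal⁻¹ := by
      rw [← ENNReal.toReal_inv, hs, inv_inv, ENNReal.toReal_sub_of_le hinv.le (by simpa using hr),
        ENNReal.toReal_inv, ENNReal.toReal_inv]
    have hs_pos : 0 < s.toReal := ENNReal.toReal_pos hs0 hs_top
    have htriple : ENNReal.HolderTriple s p r :=
      ⟨by rw [hs, inv_inv, tsub_add_cancel_of_le hinv.le]⟩
    obtain ⟨K, hK, hKl⟩ := exists_eLpNorm_norm_rpow_compl_ball_le μ hβ hs0 hs_top (by
      have := hβr hlt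
      rwa [← hs_inv, ← div_eq_mul_inv, div_lt_iff₀ hs_pos] at this)
    refine ⟨K, hK, fun f hf l hl => ?_⟩
    rw [← hs_inv]
    have hm (b : ℝ) : Measurable fun x : E => ‖x‖ ^ b := by fun_prop
    have hw : AEStronglyMeasurable (fun x => ‖x‖ ^ β * ‖f x‖) μ :=
      (hm β).aestronglyMeasurable.mul hf.norm
    calc eLpNorm f r (μ.restrict (Metric.ball 0 l)ᶜ)
        = eLpNorm ((fun x : E => ‖x‖ ^ (-β)) • fun x => ‖x‖ ^ β * ‖f x‖) r
            (μ.restrict (Metric.ball 0 l)ᶜ) := by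
          refine eLpNorm_congr_norm_ae ?_
          refine ae_restrict_of_forall_mem Metric.isOpen_ball.measurableSet.compl fun x hx => ?_
          have hx' : 0 < ‖x‖ := hl.trans_le (by simpa using hx)
          rw [Pi.smul_apply', smul_eq_mul, ← mul_assoc, ← Real.rpow_add hx']
          simp
      _ ≤ eLpNorm (fun x : E => ‖x‖ ^ (-β)) s (μ.restrict (Metric.ball 0 l)ᶜ) *
            eLpNorm (fun x => ‖x‖ ^ β * ‖f x‖) p (μ.restrict (Metric.ball 0 l)ᶜ) :=
          eLpNorm_smul_le_mul_eLpNorm hw.restrict (hm _).aestronglyMeasurable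
      _ ≤ _ := by
          gcongr
          · exact hKl l hl
          · exact Measure.restrict_le_self

lemma ae_eq_zero_of_eLpNorm_norm_rpow_mul_eq_zero [Nontrivial E] {β : ℝ} {p : ℝ≥0∞} (hp : p ≠ 0)
    {f : E → ℂ} (hf : AEStronglyMeasurable f μ)
    (h : eLpNorm (fun x => ‖x‖ ^ β * ‖f x‖) p μ = 0) : f =ᵐ[μ] 0 := by
  have hm : Measurable fun x : E => ‖x‖ ^ β := by fun_prop
  have hw : AEStronglyMeasurable (fun x => ‖x‖ ^ β * ‖f x‖) μ :=
    hm.aestronglyMeasurable.mul hf.norm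
  rw [eLpNorm_eq_zero_iff hw hp] at h
  have h0 : ∀ᵐ x ∂μ, x ≠ (0 : E) := by simp [ae_iff, measure_singleton]
  filter_upwards [h, h0] with x hx hx0
  have : ‖x‖ ^ β ≠ 0 := (Real.rpow_pos_of_pos (norm_pos_iff.2 hx0) _).ne'
  simpa [this] using hx

end Weight

lemma le_mul_rpow_mul_rpow_of_forall_le {α γ : ℝ} (hα : 0 < α) (hγ : 0 < γ) {N A B K : ℝ≥0∞}
    (hN : N ≠ ∞) (hA0 : A ≠ 0) (hA : A ≠ ∞) (hB0 : B ≠ 0) (hB : B ≠ ∞)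
    (h : ∀ R : ℝ, 0 < R →
      N ≤ ENNReal.ofReal (R ^ (-α)) * A + (2⁻¹ * N + K * ENNReal.ofReal (R ^ γ) * B)) :
    N ≤ 2 * (1 + K) * (A ^ (γ / (α + γ)) * B ^ (1 - γ / (α + γ))) := by
  obtain ⟨a, ha, rfl⟩ : ∃ a : ℝ, 0 < a ∧ A = ENNReal.ofReal a :=
    ⟨A.toReal, ENNReal.toReal_pos hA0 hA, (ENNReal.ofReal_toReal hA).symm⟩
  obtain ⟨b, hb, rfl⟩ : ∃ b : ℝ, 0 < b ∧ B = ENNReal.ofReal b :=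
    ⟨B.toReal, ENNReal.toReal_pos hB0 hB, (ENNReal.ofReal_toReal hB).symm⟩
  have hpow (e : ℝ) : ((a / b) ^ (1 / (α + γ))) ^ e = a ^ (e / (α + γ)) * b ^ (-(e / (α + γ))) := by
    rw [← Real.rpow_mul (by positivity), Real.div_rpow ha.le hb.le, Real.rpow_neg hb.le,
      div_eq_mul_inv, one_div_mul_eq_div]
  have h1 := h ((a / b) ^ (1 / (α + γ))) (by positivity)
  set M : ℝ := a ^ (γ / (α + γ)) * b ^ (1 - γ / (α + γ)) with hM
  have e1 : ((a / b) ^ (1 / (α + γ))) ^ (-α) * a = M := by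
    rw [hpow, hM]
    nth_rw 2 [← Real.rpow_one a]
    rw [mul_right_comm, ← Real.rpow_add ha]
    congr 2 <;> field_simp <;> ring
  have e2 : ((a / b) ^ (1 / (α + γ))) ^ γ * b = M := by
    rw [hpow, hM]
    nth_rw 2 [← Real.rpow_one b]
    rw [mul_assoc, ← Real.rpow_add hb]
    congr 2
    ring
  rw [ENNReal.ofReal_rpow_of_pos ha, ENNReal.ofReal_rpow_of_pos hb,
    ← ENNReal.ofReal_mul (by positivity), ← hM]
  rw [← ENNReal.ofReal_mul (by positivity), mul_assoc K, ← ENNReal.ofReal_mul (by positivity),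
    e1, e2] at h1
  have h2 : 2⁻¹ * N + 2⁻¹ * N ≤ 2⁻¹ * N + (1 + K) * ENNReal.ofReal M := by
    rw [← add_mul, ENNReal.inv_two_add_inv_two, one_mul]
    refine h1.trans_eq ?_
    ring
  have h3 := (ENNReal.add_le_add_iff_left (ENNReal.mul_ne_top (by simp) hN)).1 h2
  calc N = 2 * (2⁻¹ * N) := by
        rw [← mul_assoc, ENNReal.mul_inv_cancel two_ne_zero (by simp), one_mul]
    _ ≤ 2 * ((1 + K) * ENNReal.ofReal M) := by gcongr
    _ = _ := by ring

lemma eLpNorm_le_restrict_add_restrict_compl {X F : Type*} [MeasurableSpace X] {μ : Measure X}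
    [NormedAddCommGroup F] {f : X → F} (hf : AEStronglyMeasurable f μ) {q : ℝ≥0∞} (hq : 1 ≤ q)
    {s : Set X} (hs : MeasurableSet s) :
    eLpNorm f q μ ≤ eLpNorm f q (μ.restrict s) + eLpNorm f q (μ.restrict sᶜ) := by
  rw [← eLpNorm_indicator_eq_eLpNorm_restrict hs,
    ← eLpNorm_indicator_eq_eLpNorm_restrict hs.compl]
  conv_lhs => rw [← Set.indicator_self_add_compl s f]
  exact eLpNorm_add_le (hf.indicator hs) (hf.indicator hs.compl) hq

set_option maxHeartbeats 1000000 in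
lemma exists_eLpNorm_restrict_ball_le {d : ℕ} (hd : 1 ≤ d) {p q r : ℝ≥0∞} (hq : 1 ≤ q)
    (hq2 : q ≤ 2) (hr : 1 ≤ r) (hr2 : r ≤ 2) (hrp : r ≤ p) {β : ℝ} (hβ : 0 ≤ β)
    (hβr : r < p → (d : ℝ) * (r.toReal⁻¹ - p.toReal⁻¹) < β) :
    ∃ K : ℝ≥0∞, K ≠ ∞ ∧
      ∀ T : Lp ℂ 2 (volume : Measure (EuclideanSpace ℝ (Fin d))) →L[ℂ]
          Lp ℂ 2 (volume : Measure (EuclideanSpace ℝ (Fin d))),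
        (ContinuousLinearMap.adjoint T).comp T = ContinuousLinearMap.id ℂ _ →
        (∀ g : Lp ℂ 2 (volume : Measure (EuclideanSpace ℝ (Fin d))),
          eLpNorm g 1 volume < ∞ → eLpNorm (T g) ∞ volume ≤ eLpNorm g 1 volume) →
        (∀ g : Lp ℂ 2 (volume : Measure (EuclideanSpace ℝ (Fin d))), ‖T g‖ ≤ ‖g‖) →
        ∀ (f : Lp ℂ 2 (volume : Measure (EuclideanSpace ℝ (Fin d)))) (R : ℝ), 0 < R →
          eLpNorm (T f) q (volume.restrict (Metric.ball 0 R)) ≤ 2⁻¹ * eLpNorm (T f) q volume +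
            K * ENNReal.ofReal (R ^ (β + (d : ℝ) * (p.toReal⁻¹ + q.toReal⁻¹ - 1))) *
              eLpNorm (fun ξ => ‖ξ‖ ^ β * ‖f ξ‖) p volume := by
  have hd0 : d ≠ 0 := by omega
  obtain ⟨K, hK, hKl⟩ := exists_eLpNorm_compl_ball_le
    (volume : Measure (EuclideanSpace ℝ (Fin d))) hβ (zero_lt_one.trans_le hr).ne' hrp
    (by simpa using hβr)
  simp only [finrank_euclideanSpace, Fintype.card_fin] at hKl
  have hqinv := toReal_inv_sub_half_nonneg hq hq2
  have hrinv := toReal_inv_sub_half_nonneg hr hr2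
  obtain ⟨v, hv, hV⟩ : ∃ v : ℝ, 0 < v ∧
      volume (Metric.ball (0 : EuclideanSpace ℝ (Fin d)) 1) = ENNReal.ofReal v :=
    ⟨_, ENNReal.toReal_pos (Metric.measure_ball_pos _ _ one_pos).ne' measure_ball_lt_top.ne,
      (ENNReal.ofReal_toReal measure_ball_lt_top.ne).symm⟩
  have hball {R : ℝ} (hR : 0 < R) :
      volume (Metric.ball (0 : EuclideanSpace ℝ (Fin d)) R) = ENNReal.ofReal (R ^ d * v) := by
    rw [Measure.addHaar_ball_of_pos _ _ hR, hV, ENNReal.ofReal_mul (by positivity)]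
    simp
  obtain ⟨κ, hκ, hκd⟩ : ∃ κ : ℝ, 0 < κ ∧ κ ^ d = (4 * v ^ 2)⁻¹ :=
    ⟨((4 * v ^ 2)⁻¹) ^ (d⁻¹ : ℝ), by positivity,
      Real.rpow_inv_natCast_pow (by positivity) hd0⟩
  set δ : ℝ := -β + (d : ℝ) * (r.toReal⁻¹ - p.toReal⁻¹)
  refine ⟨K * ENNReal.ofReal (v ^ (q.toReal⁻¹ + r.toReal⁻¹ - 1) * κ ^ δ),
    ENNReal.mul_ne_top hK ENNReal.ofReal_ne_top, fun T hleft hT₁ hT₂ f R hR => ?_⟩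
  have hκR : 0 < κ / R := by positivity
  refine (eLpNorm_restrict_le_add T hleft hT₁ hT₂ f hq hq2 hr hr2
    Metric.isOpen_ball.measurableSet measure_ball_lt_top.ne
    (Metric.isOpen_ball (x := 0) (ε := κ / R)).measurableSet measure_ball_lt_top.ne).trans ?_
  gcongr ?_ * _ + ?_
  · rw [hball hR, hball hκR, ← ENNReal.ofReal_mul (by positivity)]
    have h4 : R ^ d * v * ((κ / R) ^ d * v) = 4⁻¹ := by
      rw [div_pow, hκd]
      field_simp
    rw [h4, ENNReal.ofReal_rpow_of_pos (by norm_num), ← ENNReal.ofReal_ofNat 2,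
      ← ENNReal.ofReal_inv_of_pos two_pos]
    refine ENNReal.ofReal_le_ofReal ?_
    calc (4⁻¹ : ℝ) ^ q.toReal⁻¹ ≤ 4⁻¹ ^ (1 / 2 : ℝ) :=
          Real.rpow_le_rpow_of_exponent_ge (by norm_num) (by norm_num) (by linarith)
      _ = 2⁻¹ := by
          rw [← Real.sqrt_eq_rpow, show (4⁻¹ : ℝ) = 2⁻¹ ^ 2 by norm_num,
            Real.sqrt_sq (by norm_num)]
  · refine (mul_le_mul_right (hKl f (Lp.aestronglyMeasurable f) _ hκR) _).trans_eq ?_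
    have hpow : volume (Metric.ball (0 : EuclideanSpace ℝ (Fin d)) R) ^
          (q.toReal⁻¹ + r.toReal⁻¹ - 1) * ENNReal.ofReal ((κ / R) ^ δ) =
        ENNReal.ofReal (v ^ (q.toReal⁻¹ + r.toReal⁻¹ - 1) * κ ^ δ) *
          ENNReal.ofReal (R ^ (β + (d : ℝ) * (p.toReal⁻¹ + q.toReal⁻¹ - 1))) := by
      rw [hball hR, ENNReal.ofReal_rpow_of_pos (by positivity),
        ← ENNReal.ofReal_mul (by positivity), ← ENNReal.ofReal_mul (by positivity)]
      congr 1
      rw [Real.mul_rpow (by positivity) hv.le, ← Real.rpow_natCast, ← Real.rpow_mul hR.le,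
        Real.div_rpow hκ.le hR.le, div_eq_mul_inv, ← Real.rpow_neg hR.le]
      have hexp : β + (d : ℝ) * (p.toReal⁻¹ + q.toReal⁻¹ - 1) =
          (d : ℝ) * (q.toReal⁻¹ + r.toReal⁻¹ - 1) + -δ := by
        simp only [δ]
        ring
      rw [hexp, Real.rpow_add hR]
      ring
    rw [mul_left_comm, ← mul_assoc, mul_assoc K, mul_comm (ENNReal.ofReal ((κ / R) ^ δ)), hpow,
      ← mul_assoc]

set_option maxHeartbeats 1000000 in
/-- Proposition 5.2: the multiplicative uncertainty inequality holds, with a uniform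
constant, for every special Hadamard operator (an invertible `T` on `L²` with
`T⁻¹ = T*`, bounded from `L¹ ∩ L²` to `L^∞` and contractive on `L²`). -/
theorem uncertainty_for_special_hadamard_operators
    (d : ℕ) (hd : 1 ≤ d) (p q q' : ℝ≥0∞) (hp : 1 ≤ p) (hq : 1 ≤ q) (hq2 : q ≤ 2)
    (hconj : 1/q + 1/q' = 1)
    (hprange : (q ≤ p ∧ p ≤ q') ∨ (p < q ∧ p < q'))
    (α β : ℝ) (hα : 0 < α) (hβ : 0 < β)
    (hcond1 : (p ≤ q ∧ q ≠ ∞ ∧ β = (d : ℝ) * (1 - (1/q).toReal - (1/p).toReal)) ∨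
      β > (d : ℝ) * (1 - (1/q).toReal - (1/p).toReal))
    (hcond2 : 2 < p → β > (d : ℝ) * (1/2 - (1/p).toReal))
    (θ : ℝ)
    (hθ : θ = (β + (d : ℝ) * ((1/p).toReal + (1/q).toReal - 1)) /
        (α + β + (d : ℝ) * ((1/p).toReal + (1/q).toReal - 1))) :
    ∃ C : ℝ, 0 < C ∧
      ∀ T : Lp ℂ 2 (volume : Measure (EuclideanSpace ℝ (Fin d))) →L[ℂ]
          Lp ℂ 2 (volume : Measure (EuclideanSpace ℝ (Fin d))),
        ((ContinuousLinearMap.adjoint T).comp T = ContinuousLinearMap.id ℂ _ ∧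
          T.comp (ContinuousLinearMap.adjoint T) = ContinuousLinearMap.id ℂ _) →
        (∀ g : Lp ℂ 2 (volume : Measure (EuclideanSpace ℝ (Fin d))),
          eLpNorm (⇑g) 1 volume < ∞ →
            eLpNorm (⇑(T g)) ∞ volume ≤ eLpNorm (⇑g) 1 volume) →
        (∀ g : Lp ℂ 2 (volume : Measure (EuclideanSpace ℝ (Fin d))), ‖T g‖ ≤ ‖g‖) →
        ∀ f : Lp ℂ 2 (volume : Measure (EuclideanSpace ℝ (Fin d))),
          eLpNorm (⇑(T f)) q volume ≤ ENNReal.ofReal C *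
            ((eLpNorm (fun x => ‖x‖ ^ α * ‖(T f : EuclideanSpace ℝ (Fin d) → ℂ) x‖)
                q volume) ^ θ *
              (eLpNorm (fun ξ => ‖ξ‖ ^ β * ‖(f : EuclideanSpace ℝ (Fin d) → ℂ) ξ‖)
                p volume) ^ (1 - θ)) := by
  simp only [one_div, ENNReal.toReal_inv] at hcond1 hcond2 hθ
  set γ : ℝ := β + (d : ℝ) * (p.toReal⁻¹ + q.toReal⁻¹ - 1) with hγdef
  have hγ : 0 < γ := by
    rcases hcond1 with ⟨hpq, -, heq⟩ | hlt
    · have h₁ := toReal_inv_sub_half_nonneg hq hq2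
      have h₂ := toReal_inv_sub_half_nonneg hp (hpq.trans hq2)
      have : 0 ≤ (d : ℝ) * (p.toReal⁻¹ + q.toReal⁻¹ - 1) := by
        have : 0 ≤ p.toReal⁻¹ + q.toReal⁻¹ - 1 := by linarith
        positivity
      linarith
    · linarith
  have hp0 : p ≠ 0 := (zero_lt_one.trans_le hp).ne'
  have hq0 : q ≠ 0 := (zero_lt_one.trans_le hq).ne'
  have : Nonempty (Fin d) := ⟨⟨0, hd⟩⟩
  obtain ⟨K, hK, hbound⟩ := exists_eLpNorm_restrict_ball_le hd (p := p) (r := min p 2) hq hq2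
    (le_min hp one_le_two) (min_le_right _ _) (min_le_left _ _) hβ.le (by
      intro hlt
      have h2 : 2 < p := by simpa using hlt
      simpa [min_eq_right h2.le] using hcond2 h2)
  refine ⟨(2 * (1 + K)).toReal, ENNReal.toReal_pos (by simp) (by finiteness), ?_⟩
  rintro T ⟨hleft, -⟩ hT₁ hT₂ f
  rw [ENNReal.ofReal_toReal (by finiteness)]
  set A := eLpNorm (fun x => ‖x‖ ^ α * ‖(T f : EuclideanSpace ℝ (Fin d) → ℂ) x‖) q volume
  set B := eLpNorm (fun ξ => ‖ξ‖ ^ β * ‖(f : EuclideanSpace ℝ (Fin d) → ℂ) ξ‖) p volume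
  have hθ' : θ = γ / (α + γ) := by rw [hθ, hγdef, add_assoc]
  have hθpos : 0 < θ := by rw [hθ']; positivity
  have hθlt : θ < 1 := by rw [hθ', div_lt_one (by positivity)]; linarith
  rcases eq_or_ne A 0 with hA0 | hA0
  · have h0 := ae_eq_zero_of_eLpNorm_norm_rpow_mul_eq_zero volume hq0
      (Lp.aestronglyMeasurable (T f)) hA0
    rw [eLpNorm_congr_ae h0, eLpNorm_zero]
    exact zero_le
  rcases eq_or_ne B 0 with hB0 | hB0
  · have h0 := ae_eq_zero_of_eLpNorm_norm_rpow_mul_eq_zero volume hp0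
      (Lp.aestronglyMeasurable f) hB0
    have hf : f = 0 := (Lp.eq_zero_iff_ae_eq_zero).2 h0
    rw [hf, map_zero, eLpNorm_congr_ae (Lp.coeFn_zero ℂ 2 volume), eLpNorm_zero]
    exact zero_le
  rcases eq_or_ne A ∞ with hA | hA
  · rw [hA, ENNReal.top_rpow_of_pos hθpos, ENNReal.top_mul (by simp [hB0, hθlt.le]),
      ENNReal.mul_top (by simp)]
    exact le_top
  rcases eq_or_ne B ∞ with hB | hB
  · rw [hB, ENNReal.top_rpow_of_pos (sub_pos.2 hθlt), ENNReal.mul_top (by simp [hA0, hθpos.le]),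
      ENNReal.mul_top (by simp)]
    exact le_top
  have hsplit (R : ℝ) (hR : 0 < R) : eLpNorm (T f) q volume ≤
      ENNReal.ofReal (R ^ (-α)) * A + eLpNorm (T f) q (volume.restrict (Metric.ball 0 R)) := by
    rw [add_comm]
    refine (eLpNorm_le_restrict_add_restrict_compl (Lp.aestronglyMeasurable (T f)) hq
      (Metric.isOpen_ball (x := 0) (ε := R)).measurableSet).trans ?_
    gcongr
    exact eLpNorm_compl_ball_le_rpow_neg_mul volume hα.le q (T f) hR
  have hN : eLpNorm (T f) q volume ≠ ∞ := by
    refine ne_top_of_le_ne_top ?_ (hsplit 1 one_pos)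
    have : IsFiniteMeasure ((volume : Measure (EuclideanSpace ℝ (Fin d))).restrict
      (Metric.ball 0 1)) := isFiniteMeasure_restrict.2 measure_ball_lt_top.ne
    have := (((Lp.memLp (T f)).restrict (Metric.ball 0 1)).mono_exponent hq2).eLpNorm_ne_top
    finiteness
  rw [hθ']
  refine le_mul_rpow_mul_rpow_of_forall_le hα hγ hN hA0 hA hB0 hB fun R hR => ?_
  refine (hsplit R hR).trans ?_
  gcongr
  exact hbound T hleft hT₁ hT₂ f R hR
end

section
/- Let d = 1, 1 ≤ p ≤ ∞ and β > 1 − 1/p. Then there exist q₀ ∈ [2,∞) and α₀ > 0 such that for every q ∈ [q₀,∞) and every α ∈ (0, α₀]: (i) there exists a constant C with ‖f‖_q ≤ C ( ‖ |x|^α f ‖_q + ‖ |ξ|^β f̂ ‖_p ) for all Schwartz functions f on ℝ (the Fourier-transform uncertainty inequality holds); but (ii) there is NO constant C such that for every measure-preserving bijection σ : ℝ → ℝ and every Schwartz function f on ℝ one has ‖f‖_q ≤ C ( ‖ |x|^α f ‖_q + ‖ |ξ|^β (f̂ ∘ σ) ‖_p ). In particular, since each operator T_σ f = f̂ ∘ σ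 satisfies ‖T_σ g‖_∞ ≤ ‖g‖_1, ‖T_σ g‖_2 = ‖g‖_2 and T_σ^{−1} = T_σ^*, the uncertainty inequality with these parameters fails to hold uniformly over the class of special Hadamard operators. -/
open MeasureTheory
open scoped ENNReal FourierTransform

/-- The unimodular exponential `e(t) = exp(2πit)`. -/
noncomputable def phase (t : ℝ) : ℂ := Complex.exp (Complex.I * (2 * Real.pi * t : ℝ))

lemma phase_add (s t : ℝ) : phase (s + t) = phase s * phase t := by
  rw [phase, phase, phase, ← Complex.exp_add]
  congr 1
  push_cast
  ring

@[simp] lemma phase_zero : phase 0 = 1 := by simp [phase]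

@[simp] lemma norm_phase (t : ℝ) : ‖phase t‖ = 1 := by
  rw [phase, mul_comm, Complex.norm_exp_ofReal_mul_I]

lemma phase_natCast_mul (n : ℕ) (t : ℝ) : phase (n * t) = phase t ^ n := by
  rw [phase, phase, ← Complex.exp_nat_mul]
  congr 1
  push_cast
  ring

lemma conj_phase (t : ℝ) : (starRingEnd ℂ) (phase t) = phase (-t) := by
  rw [phase, phase, ← Complex.exp_conj]
  congr 1
  rw [map_mul, Complex.conj_I, Complex.conj_ofReal]
  push_cast
  ring

lemma continuous_phase : Continuous phase := by
  unfold phase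
  fun_prop

lemma norm_phase_sub_one_le (t : ℝ) : ‖phase t - 1‖ ≤ 2 * Real.pi * |t| := by
  have h := Real.norm_exp_I_mul_ofReal_sub_one_le (x := 2 * Real.pi * t)
  rwa [Real.norm_eq_abs, abs_mul, abs_of_pos Real.two_pi_pos] at h

lemma le_norm_phase_sub_one {t : ℝ} (ht : |t| ≤ 1 / 2) : 4 * |t| ≤ ‖phase t - 1‖ := by
  rw [phase, Complex.norm_exp_I_mul_ofReal_sub_one, norm_mul, Real.norm_eq_abs, Real.norm_eq_abs,
    abs_of_pos (zero_lt_two' ℝ), Real.abs_sin_eq_sin_abs_of_abs_le_pi]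
  · have h := Real.mul_le_sin (x := |2 * Real.pi * t / 2|) (abs_nonneg _) (by
      rw [show 2 * Real.pi * t / 2 = Real.pi * t by ring, abs_mul, abs_of_pos Real.pi_pos]
      nlinarith [Real.pi_pos])
    have e : 2 / Real.pi * |2 * Real.pi * t / 2| = 2 * |t| := by
      rw [show 2 * Real.pi * t / 2 = Real.pi * t by ring, abs_mul, abs_of_pos Real.pi_pos]
      field_simp
    linarith
  · rw [show 2 * Real.pi * t / 2 = Real.pi * t by ring, abs_mul, abs_of_pos Real.pi_pos]
    nlinarith [Real.pi_pos]

lemma norm_sum_phase_mul_le {t : ℝ} (ht0 : t ≠ 0) (ht : |t| ≤ 1 / 2) (n : ℕ) :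
    ‖∑ k ∈ Finset.range n, phase (k * t)‖ ≤ 1 / (2 * |t|) := by
  have hpos : 0 < |t| := abs_pos.2 ht0
  have hlow := le_norm_phase_sub_one ht
  have hne : phase t ≠ 1 := by
    intro h
    rw [h] at hlow
    rw [sub_self, norm_zero] at hlow
    linarith
  simp_rw [phase_natCast_mul]
  rw [geom_sum_eq hne, norm_div, div_le_div_iff₀ (by linarith) (by linarith)]
  have h2 : ‖phase t ^ n - 1‖ ≤ 2 := by
    refine (norm_sub_le _ _).trans ?_
    simp only [norm_pow, norm_phase, one_pow, norm_one]
    norm_num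
  nlinarith

/-- The inequality behind Weyl differencing. -/
lemma norm_sum_sq_le_sum_norm_correlation (u : ℕ → ℂ) (n : ℕ) :
    ‖∑ k ∈ Finset.range n, u k‖ ^ 2 ≤
      2 * ∑ h ∈ Finset.range n,
        ‖∑ k ∈ Finset.range (n - h), u (k + h) * (starRingEnd ℂ) (u k)‖ := by
  have h1 : ∀ n : ℕ, ‖∑ k ∈ Finset.range n, u k‖ ^ 2 ≤ 2 * (∑ j ∈ Finset.range n,
      ∑ k ∈ Finset.range (j + 1), u j * (starRingEnd ℂ) (u k)).re := by
    intro n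
    induction n with
    | zero => simp
    | succ n ih =>
      rw [Finset.sum_range_succ, Finset.sum_range_succ _ n, Complex.add_re,
        Finset.sum_range_succ _ n, ← Finset.mul_sum, ← map_sum]
      set S := ∑ k ∈ Finset.range n, u k
      rw [← Complex.normSq_eq_norm_sq] at ih ⊢
      have e1 : (u n * (starRingEnd ℂ) (u n)).re = Complex.normSq (u n) := by
        rw [Complex.mul_conj]; simp
      have e2 : (u n * (starRingEnd ℂ) S).re = (S * (starRingEnd ℂ) (u n)).re := by
        simp; ring
      rw [Complex.normSq_add, Complex.add_re, e1, e2]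
      nlinarith [Complex.normSq_nonneg (u n)]
  have h2 : ∑ j ∈ Finset.range n, ∑ k ∈ Finset.range (j + 1), u j * (starRingEnd ℂ) (u k) =
      ∑ h ∈ Finset.range n, ∑ k ∈ Finset.range (n - h), u (k + h) * (starRingEnd ℂ) (u k) := by
    rw [← Finset.sum_range_diag_flip n (fun h k => u (k + h) * (starRingEnd ℂ) (u k))]
    refine Finset.sum_congr rfl fun j _ => ?_
    rw [← Finset.sum_range_reflect]
    refine Finset.sum_congr rfl fun k hk => ?_
    have hk' : k ≤ j := Nat.lt_succ_iff.1 (Finset.mem_range.1 hk)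
    rw [Nat.sub_add_cancel hk', show j + 1 - 1 - k = j - k by omega]
  refine (h1 n).trans ?_
  rw [h2]
  gcongr
  exact (Complex.re_le_norm _).trans (norm_sum_le _ _)

/-- Short quadratic Weyl sums. -/
lemma norm_sum_phase_sq_short {y : ℝ} (hy : y ≠ 0) {n : ℕ} (hn : 1 ≤ n) (hny : 4 * n * |y| ≤ 1)
    (a : ℕ) :
    ‖∑ k ∈ Finset.range n, phase (((a + k : ℕ) : ℝ) ^ 2 * y)‖ ^ 2 ≤ (1 + Real.log n) / |y| := by
  have hypos : 0 < |y| := abs_pos.2 hy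
  refine (norm_sum_sq_le_sum_norm_correlation _ n).trans ?_
  obtain ⟨m, rfl⟩ : ∃ m, n = m + 1 := ⟨n - 1, by omega⟩
  rw [Finset.sum_range_succ']
  have h0 : ‖∑ k ∈ Finset.range (m + 1 - 0), phase (((a + (k + 0) : ℕ) : ℝ) ^ 2 * y) *
      (starRingEnd ℂ) (phase (((a + k : ℕ) : ℝ) ^ 2 * y))‖ ≤ m + 1 := by
    refine (norm_sum_le _ _).trans ?_
    simp
  have h1 : ∀ h ∈ Finset.range m, ‖∑ k ∈ Finset.range (m + 1 - (h + 1)),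
      phase (((a + (k + (h + 1)) : ℕ) : ℝ) ^ 2 * y) *
      (starRingEnd ℂ) (phase (((a + k : ℕ) : ℝ) ^ 2 * y))‖ ≤
      1 / (4 * |y|) * ((h : ℝ) + 1)⁻¹ := by
    intro h hh
    have hhm : (h : ℝ) + 1 ≤ m := by exact_mod_cast Finset.mem_range.1 hh
    have e : ∀ k : ℕ, phase (((a + (k + (h + 1)) : ℕ) : ℝ) ^ 2 * y) *
      (starRingEnd ℂ) (phase (((a + k : ℕ) : ℝ) ^ 2 * y)) =
      phase ((2 * a * (h + 1) + (h + 1) ^ 2) * y) * phase (k * (2 * (h + 1) * y)) := by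
      intro k
      rw [conj_phase, ← phase_add, ← phase_add]
      congr 1
      push_cast
      ring
    simp_rw [e]
    rw [← Finset.mul_sum, norm_mul, norm_phase, one_mul]
    have habs : |2 * ((h : ℝ) + 1) * y| = 2 * (h + 1) * |y| := by
      rw [abs_mul, abs_of_pos (by positivity)]
    refine (norm_sum_phase_mul_le (by positivity) ?_ _).trans_eq ?_
    · rw [habs]
      push_cast at hny
      nlinarith
    · rw [habs]
      field_simp
      norm_num
  have h2 := Finset.sum_le_sum h1
  rw [← Finset.mul_sum] at h2
  have h3 : ∑ h ∈ Finset.range m, ((h : ℝ) + 1)⁻¹ ≤ 1 + Real.log ((m + 1 : ℕ) : ℝ) := by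
    have := harmonic_le_one_add_log m
    have e : ((harmonic m : ℚ) : ℝ) = ∑ h ∈ Finset.range m, ((h : ℝ) + 1)⁻¹ := by
      simp [harmonic]
    rw [← e]
    refine this.trans ?_
    rcases Nat.eq_zero_or_pos m with rfl | hm
    · simp
    · gcongr
      simp
  set Lg := Real.log ((m + 1 : ℕ) : ℝ)
  have hLg : 0 ≤ Lg := Real.log_natCast_nonneg _
  have h4 : (m + 1 : ℝ) ≤ 1 / (4 * |y|) := by
    rw [le_div_iff₀ (by positivity)]
    push_cast at hny
    linarith
  calc 2 * (_ + _) ≤ 2 * (1 / (4 * |y|) * (1 + Lg) + 1 / (4 * |y|)) := by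
        gcongr
        · exact h2.trans (by gcongr)
        · exact h0.trans h4
    _ ≤ (1 + Lg) / |y| := by
        have e : 2 * (1 / (4 * |y|) * (1 + Lg) + 1 / (4 * |y|)) = (1 + Lg / 2) / |y| := by
          field_simp
          ring
        rw [e]
        gcongr
        linarith

lemma norm_sum_range_le_of_blocks {u : ℕ → ℂ} {H : ℕ} {E : ℝ}
    (hE : ∀ a n : ℕ, n ≤ H → ‖∑ k ∈ Finset.range n, u (a + k)‖ ≤ E) (Q : ℕ) :
    ∀ a n : ℕ, n ≤ Q * H → ‖∑ k ∈ Finset.range n, u (a + k)‖ ≤ Q * E := by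
  induction Q with
  | zero =>
    intro a n hn
    obtain rfl : n = 0 := by omega
    simp
  | succ Q ih =>
    intro a n hn
    rcases le_total n H with h | h
    · refine (hE a n h).trans ?_
      have : 0 ≤ E := (norm_nonneg _).trans (hE 0 0 (Nat.zero_le _))
      push_cast
      nlinarith [Q.cast_nonneg (α := ℝ)]
    · obtain ⟨r, rfl⟩ := Nat.exists_eq_add_of_le h
      rw [Finset.sum_range_add]
      refine (norm_add_le _ _).trans ?_
      have h1 := hE a H le_rfl
      have h2 := ih (a + H) r (by rw [Nat.succ_mul] at hn; omega)
      simp_rw [add_assoc] at h2 ⊢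
      push_cast
      linarith

/-- Quadratic Weyl sums away from rational points other than `0`. -/
lemma norm_sum_phase_sq_le {y : ℝ} (hy : y ≠ 0) (hy4 : |y| ≤ 1 / 4) {n : ℕ} (hn : 1 ≤ n) (a : ℕ) :
    ‖∑ k ∈ Finset.range n, phase (((a + k : ℕ) : ℝ) ^ 2 * y)‖ ^ 2 ≤
      256 * (1 + Real.log n) * (1 / |y| + n ^ 2 * |y|) := by
  have hypos : 0 < |y| := abs_pos.2 hy
  have hlog : 0 ≤ Real.log n := Real.log_natCast_nonneg _
  rcases le_or_gt (4 * n * |y|) 1 with h | h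
  · refine (norm_sum_phase_sq_short hy hn h a).trans ?_
    have : 0 ≤ (1 + Real.log n) * (1 / |y|) := by positivity
    have : 0 ≤ (1 + Real.log n) * (n ^ 2 * |y|) := by positivity
    rw [div_eq_mul_one_div]
    nlinarith
  · set H := ⌊1 / (4 * |y|)⌋₊ with hH
    have hx1 : 1 ≤ 1 / (4 * |y|) := by
      rw [le_div_iff₀ (by positivity)]; linarith
    have hH1 : 1 ≤ H := Nat.le_floor (by simpa using hx1)
    have hHle : (H : ℝ) ≤ 1 / (4 * |y|) := Nat.floor_le (by positivity)
    have hHlt : 1 / (4 * |y|) < H + 1 := Nat.lt_floor_add_one _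
    have hH1' : (1 : ℝ) ≤ H := by exact_mod_cast hH1
    have hHy : 4 * H * |y| ≤ 1 := by
      rw [le_div_iff₀ (by positivity)] at hHle
      linarith
    have hHy' : 1 ≤ 8 * |y| * H := by
      rw [div_lt_iff₀ (by positivity)] at hHlt
      nlinarith
    have hHn : (H : ℝ) ≤ n := by
      by_contra hc
      push Not at hc
      nlinarith
    set E := Real.sqrt ((1 + Real.log n) / |y|) with hE
    have hblock : ∀ a m : ℕ, m ≤ H →
        ‖∑ k ∈ Finset.range m, phase (((a + k : ℕ) : ℝ) ^ 2 * y)‖ ≤ E := by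
      intro a m hm
      rcases Nat.eq_zero_or_pos m with rfl | hm0
      · rw [Finset.range_zero, Finset.sum_empty, norm_zero]
        exact Real.sqrt_nonneg _
      · have hmH : (m : ℝ) ≤ H := by exact_mod_cast hm
        refine Real.le_sqrt_of_sq_le ((norm_sum_phase_sq_short hy hm0 ?_ a).trans ?_)
        · nlinarith
        · have : (0 : ℝ) < m := by exact_mod_cast hm0
          gcongr
          exact_mod_cast hmH.trans hHn
    have hQ := norm_sum_range_le_of_blocks (u := fun k : ℕ => phase ((k : ℝ) ^ 2 * y))
      hblock (⌈(n : ℝ) / H⌉₊) a n (by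
        have := Nat.le_ceil ((n : ℝ) / H)
        rw [div_le_iff₀ (by positivity)] at this
        exact_mod_cast this)
    have hQle : (⌈(n : ℝ) / H⌉₊ : ℝ) ≤ 16 * n * |y| := by
      have h1 := Nat.ceil_lt_add_one (a := (n : ℝ) / H) (by positivity)
      have h2 : (1 : ℝ) ≤ n / H := by rw [le_div_iff₀ (by positivity)]; linarith
      have h3 : (n : ℝ) / H ≤ 8 * n * |y| := by
        rw [div_le_iff₀ (by positivity)]
        nlinarith [n.cast_nonneg (α := ℝ)]
      linarith
    have hE0 : 0 ≤ E := Real.sqrt_nonneg _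
    calc _ ≤ ((16 * n * |y|) * E) ^ 2 := by
          gcongr
          exact hQ.trans (by gcongr)
      _ = 256 * (1 + Real.log n) * (n ^ 2 * |y|) := by
          rw [mul_pow, hE, Real.sq_sqrt (by positivity)]
          field_simp
          norm_num
      _ ≤ _ := by
          gcongr
          have : 0 ≤ 1 / |y| := by positivity
          linarith

lemma fourierInv_eq_integral_phase (g : ℝ → ℂ) (x : ℝ) :
    𝓕⁻ g x = ∫ ξ, phase (ξ * x) * g ξ := by
  rw [Real.fourierInv_eq']
  refine integral_congr_ae (Filter.Eventually.of_forall fun ξ => ?_)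
  simp only [phase, smul_eq_mul, mul_comm Complex.I]
  congr 4
  simp [mul_comm]

lemma schwartz_eq_integral_phase (f : SchwartzMap ℝ ℂ) (x : ℝ) :
    f x = ∫ ξ, phase (ξ * x) * 𝓕 (⇑f) ξ := by
  rw [← fourierInv_eq_integral_phase,
    Continuous.fourierInv_fourier_eq f.continuous f.integrable (𝓕 f).integrable]

lemma enorm_le_sum_shift_add_lintegral (f : SchwartzMap ℝ ℂ) (k : ℕ) (x : ℝ) :
    ‖f x‖ₑ ≤ ∑ j ∈ Finset.range k, (k.choose (j + 1) : ℝ≥0∞) * ‖f (x + 2 * (j + 1))‖ₑ +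
      ∫⁻ ξ, ‖𝓕 (⇑f) ξ‖ₑ * ‖phase (2 * ξ) - 1‖ₑ ^ k := by
  have hexp : ∫ ξ, phase (ξ * x) * (1 - phase (2 * ξ)) ^ k * 𝓕 (⇑f) ξ =
      ∑ j ∈ Finset.range (k + 1), (-1) ^ j * (k.choose j : ℂ) * f (x + 2 * j) := by
    have hi : ∀ y : ℝ, Integrable fun ξ => phase (ξ * y) * 𝓕 (⇑f) ξ := by
      intro y
      refine ((𝓕 f).integrable).bdd_mul (c := 1) ?_ ?_
      · exact (continuous_phase.comp (continuous_id.mul continuous_const)).aestronglyMeasurable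
      · simp
    simp_rw [schwartz_eq_integral_phase f (x + _), ← integral_const_mul]
    rw [← integral_finsetSum _ fun j _ => (hi _).const_mul _]
    refine integral_congr_ae (Filter.Eventually.of_forall fun ξ => ?_)
    simp only
    rw [show (1 - phase (2 * ξ)) = -phase (2 * ξ) + 1 by ring, add_pow, Finset.mul_sum,
      Finset.sum_mul]
    refine Finset.sum_congr rfl fun j _ => ?_
    rw [show ξ * (x + 2 * j) = ξ * x + j * (2 * ξ) by ring, phase_add, phase_natCast_mul,
      neg_pow]
    ring
  rw [Finset.sum_range_succ'] at hexp
  simp only [pow_zero, Nat.choose_zero_right, Nat.cast_one, Nat.cast_zero, mul_zero, add_zero,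
    one_mul] at hexp
  rw [← sub_eq_iff_eq_add'] at hexp
  rw [← hexp, sub_eq_add_neg, add_comm]
  refine (enorm_add_le _ _).trans (add_le_add ?_ ?_)
  · rw [enorm_neg]
    refine (enorm_sum_le _ _).trans (Finset.sum_le_sum fun j _ => ?_)
    rw [enorm_mul, enorm_mul, enorm_pow, enorm_neg, enorm_one, one_pow, one_mul]
    push_cast
    gcongr
    simp [enorm_eq_nnnorm]
  · refine (enorm_integral_le_lintegral_enorm _).trans_eq (lintegral_congr fun ξ => ?_)
    rw [enorm_mul, enorm_mul, enorm_pow, ← enorm_neg (1 - _), neg_sub, mul_comm]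
    congr 1
    rw [show ‖phase (ξ * x)‖ₑ = 1 by simp [← ofReal_norm], one_mul]

lemma norm_phase_sub_one_pow_le {β : ℝ} (hβ : 0 ≤ β) {k : ℕ} (hk : β ≤ k) (ξ : ℝ) :
    ‖phase (2 * ξ) - 1‖ ^ k ≤
      (4 * Real.pi) ^ k * 2 ^ β * (|ξ| ^ β * (1 + |ξ|) ^ (-β)) := by
  have h4 : ‖phase (2 * ξ) - 1‖ ≤ 4 * Real.pi * |ξ| := by
    refine (norm_phase_sub_one_le _).trans_eq ?_
    rw [abs_mul, abs_of_pos (zero_lt_two' ℝ)]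
    ring
  have hpos : (0 : ℝ) < 1 + |ξ| := by positivity
  rcases le_total |ξ| 1 with h | h
  · have h1 : (1 : ℝ) ≤ 2 ^ β * (1 + |ξ|) ^ (-β) := by
      rw [Real.rpow_neg hpos.le, ← div_eq_mul_inv, one_le_div (by positivity)]
      exact Real.rpow_le_rpow hpos.le (by linarith) hβ
    have h2 : |ξ| ^ k ≤ |ξ| ^ β := by
      rcases (abs_nonneg ξ).eq_or_lt with h0 | h0
      · rw [← h0]
        rcases hβ.eq_or_lt with hb | hb
        · rw [← hb]
          simpa using pow_le_one₀ (n := k) le_rfl zero_le_one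
        · have : k ≠ 0 := by
            rintro rfl
            simp at hk
            linarith
          simp [this, hb.ne']
      · rw [← Real.rpow_natCast]
        exact Real.rpow_le_rpow_of_exponent_ge h0 h hk
    calc ‖phase (2 * ξ) - 1‖ ^ k ≤ (4 * Real.pi * |ξ|) ^ k := by gcongr
      _ = (4 * Real.pi) ^ k * (|ξ| ^ k * 1) := by rw [mul_pow, mul_one]
      _ ≤ (4 * Real.pi) ^ k * (|ξ| ^ β * (2 ^ β * (1 + |ξ|) ^ (-β))) := by gcongr
      _ = _ := by ring
  · have h2 : ‖phase (2 * ξ) - 1‖ ≤ 4 * Real.pi := by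
      refine (norm_sub_le _ _).trans ?_
      rw [norm_phase, norm_one]
      linarith [Real.pi_gt_three]
    have h1 : (1 : ℝ) ≤ 2 ^ β * (|ξ| ^ β * (1 + |ξ|) ^ (-β)) := by
      rw [Real.rpow_neg hpos.le, ← mul_assoc, ← div_eq_mul_inv, one_le_div (by positivity),
        ← Real.mul_rpow zero_le_two (abs_nonneg _)]
      exact Real.rpow_le_rpow hpos.le (by linarith) hβ
    calc ‖phase (2 * ξ) - 1‖ ^ k ≤ (4 * Real.pi) ^ k * 1 := by rw [mul_one]; gcongr
      _ ≤ (4 * Real.pi) ^ k * (2 ^ β * (|ξ| ^ β * (1 + |ξ|) ^ (-β))) := by gcongr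
      _ = _ := by ring

lemma eLpNorm_one_add_abs_rpow_lt_top {p p' : ℝ≥0∞} [hpp : ENNReal.HolderConjugate p p']
    {β : ℝ} (hβ0 : 0 ≤ β) (hβ : 1 - (1 / p).toReal < β) :
    eLpNorm (fun ξ : ℝ => (1 + |ξ|) ^ (-β)) p' volume < ∞ := by
  have hone : ∀ ξ : ℝ, (1 + |ξ|) ^ (-β) ≤ 1 := fun ξ =>
    Real.rpow_le_one_of_one_le_of_nonpos (by linarith [abs_nonneg ξ]) (by linarith)
  have hnn : ∀ ξ : ℝ, 0 ≤ (1 + |ξ|) ^ (-β) := fun ξ => by positivity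
  rcases eq_or_ne p' ∞ with rfl | htop
  · rw [eLpNorm_exponent_top]
    refine (eLpNormEssSup_le_of_ae_bound (C := 1) (.of_forall fun ξ => ?_)).trans_lt
      ENNReal.ofReal_lt_top
    rw [Real.norm_of_nonneg (hnn ξ)]
    exact hone ξ
  · have hp'1 : 1 ≤ p' := ENNReal.HolderConjugate.one_le p' p
    have hp'0 : p' ≠ 0 := (zero_lt_one.trans_le hp'1).ne'
    have hpos : 0 < p'.toReal := ENNReal.toReal_pos hp'0 htop
    have hrel : 1 - (1 / p).toReal = 1 / p'.toReal := by
      have h := ENNReal.holderConjugate_iff.1 hpp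
      have h1 : p⁻¹ ≠ ∞ := by
        intro hc; rw [hc] at h; simp at h
      have h2 : p'⁻¹ ≠ ∞ := by
        intro hc; rw [hc] at h; simp at h
      have h3 := congrArg ENNReal.toReal h
      rw [ENNReal.toReal_add h1 h2] at h3
      simp only [ENNReal.toReal_inv, ENNReal.toReal_one] at h3
      simp only [one_div, ENNReal.toReal_inv]
      linarith
    rw [hrel, div_lt_iff₀ hpos] at hβ
    rw [eLpNorm_lt_top_iff_lintegral_rpow_enorm_lt_top hp'0 htop]
    have hfin := finite_integral_one_add_norm (E := ℝ) (μ := volume) (r := β * p'.toReal)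
      (by simpa using hβ)
    refine lt_of_le_of_lt (le_of_eq (lintegral_congr fun ξ => ?_)) hfin
    rw [Real.enorm_eq_ofReal (hnn ξ), ENNReal.ofReal_rpow_of_nonneg (hnn ξ) hpos.le,
      ← Real.rpow_mul (by positivity), neg_mul, Real.norm_eq_abs]

/-- Pointwise control of a Schwartz function by its translates and by `‖|ξ|^β f̂‖_p`. -/
lemma exists_enorm_le_sum_shift_add_eLpNorm {p : ℝ≥0∞} (hp : 1 ≤ p) {β : ℝ} (hβ0 : 0 ≤ β)
    (hβ : 1 - (1 / p).toReal < β) :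
    ∃ (k : ℕ) (W : ℝ≥0∞), W ≠ ∞ ∧ ∀ (f : SchwartzMap ℝ ℂ) (x : ℝ),
      ‖f x‖ₑ ≤ ∑ j ∈ Finset.range k, (k.choose (j + 1) : ℝ≥0∞) * ‖f (x + 2 * (j + 1))‖ₑ +
        W * eLpNorm (fun ξ => |ξ| ^ β * ‖𝓕 (⇑f) ξ‖) p volume := by
  obtain ⟨k, hk⟩ := exists_nat_ge β
  have : ENNReal.HolderConjugate p (ENNReal.conjExponent p) :=
    ENNReal.HolderConjugate.conjExponent hp
  have hW := eLpNorm_one_add_abs_rpow_lt_top (p := p) (p' := ENNReal.conjExponent p) hβ0 hβ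
  set c : ℝ := (4 * Real.pi) ^ k * 2 ^ β
  have hc : 0 ≤ c := by positivity
  refine ⟨k, ENNReal.ofReal c * eLpNorm (fun ξ : ℝ => (1 + |ξ|) ^ (-β))
    (ENNReal.conjExponent p) volume, ENNReal.mul_ne_top ENNReal.ofReal_ne_top hW.ne,
    fun f x => (enorm_le_sum_shift_add_lintegral f k x).trans ?_⟩
  gcongr
  have hmeas1 : AEStronglyMeasurable (fun ξ : ℝ => (1 + |ξ|) ^ (-β)) volume :=
    (by fun_prop : Measurable fun ξ : ℝ => (1 + |ξ|) ^ (-β)).aestronglyMeasurable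
  have hmeas2 : AEStronglyMeasurable (fun ξ : ℝ => |ξ| ^ β * ‖𝓕 (⇑f) ξ‖) volume := by
    have h1 : Measurable fun ξ : ℝ => |ξ| ^ β := by fun_prop
    have h2 : Continuous fun ξ : ℝ => ‖𝓕 (⇑f) ξ‖ := (𝓕 f).continuous.norm
    exact (h1.mul h2.measurable).aestronglyMeasurable
  have hH := eLpNorm_smul_le_mul_eLpNorm (p := p) (q := ENNReal.conjExponent p) (r := 1)
    hmeas1 hmeas2
  rw [eLpNorm_one_eq_lintegral_enorm] at hH
  calc ∫⁻ ξ, ‖𝓕 (⇑f) ξ‖ₑ * ‖phase (2 * ξ) - 1‖ₑ ^ k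
      ≤ ∫⁻ ξ, ENNReal.ofReal c * ‖((fun ξ : ℝ => |ξ| ^ β * ‖𝓕 (⇑f) ξ‖) •
          fun ξ : ℝ => (1 + |ξ|) ^ (-β)) ξ‖ₑ := by
        refine lintegral_mono fun ξ => ?_
        have h := norm_phase_sub_one_pow_le hβ0 hk ξ
        have hnn : 0 ≤ (|ξ| ^ β * ‖𝓕 (⇑f) ξ‖) * (1 + |ξ|) ^ (-β) := by positivity
        rw [Pi.smul_apply', smul_eq_mul, Real.enorm_eq_ofReal hnn, ← ENNReal.ofReal_mul hc,
          ← enorm_pow, ← enorm_mul, ← ofReal_norm]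
        apply ENNReal.ofReal_le_ofReal
        rw [norm_mul, norm_pow]
        calc _ ≤ ‖𝓕 (⇑f) ξ‖ * (c * (|ξ| ^ β * (1 + |ξ|) ^ (-β))) := by gcongr
          _ = _ := by ring
    _ = ENNReal.ofReal c * ∫⁻ ξ, ‖((fun ξ : ℝ => |ξ| ^ β * ‖𝓕 (⇑f) ξ‖) •
          fun ξ : ℝ => (1 + |ξ|) ^ (-β)) ξ‖ₑ :=
        lintegral_const_mul' _ _ ENNReal.ofReal_ne_top
    _ ≤ _ := by
        rw [mul_assoc]
        gcongr
        rwa [mul_comm (eLpNorm (fun ξ : ℝ => (1 + |ξ|) ^ (-β)) _ _)]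

/-- The Fourier uncertainty inequality. -/
lemma exists_uncertainty_fourier {p : ℝ≥0∞} (hp : 1 ≤ p) {β : ℝ} (hβ0 : 0 ≤ β)
    (hβ : 1 - (1 / p).toReal < β) {q : ℝ} (hq : 1 ≤ q) {α : ℝ} (hα : 0 ≤ α) :
    ∃ C : ℝ, 0 < C ∧ ∀ f : SchwartzMap ℝ ℂ,
      eLpNorm (⇑f) (ENNReal.ofReal q) volume ≤ ENNReal.ofReal C *
        (eLpNorm (fun x => |x| ^ α * ‖f x‖) (ENNReal.ofReal q) volume +
          eLpNorm (fun ξ => |ξ| ^ β * ‖𝓕 (⇑f) ξ‖) p volume) := by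
  obtain ⟨k, W, hW, hf⟩ := exists_enorm_le_sum_shift_add_eLpNorm hp hβ0 hβ
  have hq0 : 0 < q := by linarith
  have hq1 : 1 ≤ ENNReal.ofReal q := by rwa [ENNReal.one_le_ofReal]
  set M : ℝ≥0∞ := 1 + ∑ j ∈ Finset.range k, (k.choose (j + 1) : ℝ≥0∞) +
    W * 2 ^ (1 / (ENNReal.ofReal q).toReal) with hM
  have hMtop : M ≠ ∞ := by
    have h2 : (2 : ℝ≥0∞) ^ (1 / (ENNReal.ofReal q).toReal) ≠ ∞ :=
      ENNReal.rpow_ne_top_of_nonneg (by positivity) ENNReal.ofNat_ne_top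
    have h3 : ∑ j ∈ Finset.range k, (k.choose (j + 1) : ℝ≥0∞) ≠ ∞ :=
      ENNReal.sum_ne_top.2 fun j _ => ENNReal.natCast_ne_top _
    simp only [hM, ne_eq, ENNReal.add_eq_top, ENNReal.one_ne_top, h3, false_or, or_self]
    exact ENNReal.mul_ne_top hW h2
  have hM0 : M ≠ 0 := by
    rw [hM, add_assoc]
    exact (zero_lt_one.trans_le le_self_add).ne'
  refine ⟨M.toReal, ENNReal.toReal_pos hM0 hMtop, fun f => ?_⟩
  rw [ENNReal.ofReal_toReal hMtop]
  set A := eLpNorm (fun x => |x| ^ α * ‖f x‖) (ENNReal.ofReal q) volume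
  set B := eLpNorm (fun ξ => |ξ| ^ β * ‖𝓕 (⇑f) ξ‖) p volume
  set G : ℝ → ℝ≥0∞ := fun x => ‖|x| ^ α * ‖f x‖‖ₑ with hG
  have hGA : eLpNorm G (ENNReal.ofReal q) volume = A := eLpNorm_enorm _
  have hGmeas : Measurable G := by
    have h1 : Measurable fun x : ℝ => |x| ^ α := by fun_prop
    exact (h1.mul f.continuous.norm.measurable).enorm
  have hGle : ∀ x : ℝ, 1 ≤ |x| → ‖f x‖ₑ ≤ G x := by
    intro x hx
    rw [hG]
    simp only [enorm_mul, enorm_norm]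
    refine le_mul_of_one_le_left zero_le ?_
    rw [Real.enorm_eq_ofReal (by positivity), ENNReal.one_le_ofReal]
    exact Real.one_le_rpow hx hα
  set S : ℕ → ℝ → ℝ≥0∞ := fun j x => (k.choose (j + 1) : ℝ≥0∞) * G (x + 2 * (j + 1)) with hS
  have hSmeas : ∀ j, Measurable (S j) :=
    fun j => (hGmeas.comp (measurable_id.add_const _)).const_mul _
  have hSsum : Measurable (∑ j ∈ Finset.range k, S j) := by
    rw [Finset.sum_fn]
    exact Finset.measurable_fun_sum _ fun j _ => hSmeas j
  have hSle : ∀ j, eLpNorm (S j) (ENNReal.ofReal q) volume ≤ (k.choose (j + 1) : ℝ≥0∞) * A := by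
    intro j
    have hmp : MeasurePreserving (fun x : ℝ => x + 2 * ((j : ℝ) + 1)) volume volume :=
      measurePreserving_add_right volume _
    rw [← hGA, ← eLpNorm_comp_measurePreserving hGmeas.aestronglyMeasurable hmp]
    refine eLpNorm_le_mul_eLpNorm_of_ae_le_mul'' _
      (hGmeas.comp hmp.measurable).aestronglyMeasurable (Filter.Eventually.of_forall fun x => ?_)
    simp [hS]
  set T : ℝ → ℝ≥0∞ := (Set.Icc (-1 : ℝ) 1).indicator fun _ => W * B with hT
  have hTmeas : Measurable T := measurable_const.indicator measurableSet_Icc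
  have hTle : eLpNorm T (ENNReal.ofReal q) volume ≤
      W * B * 2 ^ (1 / (ENNReal.ofReal q).toReal) := by
    refine (eLpNorm_indicator_const_le _ _).trans_eq ?_
    rw [Real.volume_Icc, enorm_eq_self]
    norm_num
  have hpt : ∀ x, ‖f x‖ₑ ≤ ‖(G + (∑ j ∈ Finset.range k, S j) + T) x‖ₑ := by
    intro x
    simp only [enorm_eq_self, Pi.add_apply, Finset.sum_apply]
    by_cases hx : x ∈ Set.Icc (-1 : ℝ) 1
    · rw [hT, Set.indicator_of_mem hx]
      refine (hf f x).trans ?_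
      gcongr
      refine le_add_of_nonneg_of_le zero_le (Finset.sum_le_sum fun j _ => ?_)
      simp only [hS]
      gcongr
      refine hGle _ (le_abs.2 (Or.inl ?_))
      linarith [hx.1, j.cast_nonneg (α := ℝ)]
    · rw [add_assoc]
      refine le_add_of_le_of_nonneg (hGle _ ?_) zero_le
      by_contra hc
      exact hx (abs_le.1 (not_le.1 hc).le)
  calc eLpNorm (⇑f) (ENNReal.ofReal q) volume
      ≤ eLpNorm (G + (∑ j ∈ Finset.range k, S j) + T) (ENNReal.ofReal q) volume :=
        eLpNorm_mono_enorm hpt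
    _ ≤ eLpNorm G (ENNReal.ofReal q) volume +
          ∑ j ∈ Finset.range k, eLpNorm (S j) (ENNReal.ofReal q) volume +
          eLpNorm T (ENNReal.ofReal q) volume := by
        refine (eLpNorm_add_le (hGmeas.add hSsum).aestronglyMeasurable
          hTmeas.aestronglyMeasurable hq1).trans ?_
        gcongr
        refine (eLpNorm_add_le hGmeas.aestronglyMeasurable hSsum.aestronglyMeasurable hq1).trans ?_
        gcongr
        exact eLpNorm_sum_le (fun j _ => (hSmeas j).aestronglyMeasurable) hq1
    _ ≤ A + ∑ j ∈ Finset.range k, (k.choose (j + 1) : ℝ≥0∞) * A +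
          W * B * 2 ^ (1 / (ENNReal.ofReal q).toReal) := by
        rw [hGA]
        gcongr with j
        exact hSle j
    _ ≤ M * A + M * B := by
        have e : A + ∑ j ∈ Finset.range k, (k.choose (j + 1) : ℝ≥0∞) * A =
            (1 + ∑ j ∈ Finset.range k, (k.choose (j + 1) : ℝ≥0∞)) * A := by
          rw [← Finset.sum_mul, add_mul, one_mul]
        rw [e, mul_right_comm]
        gcongr
        · exact le_self_add
        · exact le_add_self
    _ = M * (A + B) := (mul_add _ _ _).symm

lemma exists_perm_preimage_subset_range (S : Finset ℤ) {K : ℕ} (hS : S.card ≤ K) :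
    ∃ π : Equiv.Perm ℤ, ∀ i, π i ∈ S → 0 ≤ i ∧ i < K := by
  let x : Fin S.card ↪ ℤ := ⟨fun j => ((j : ℕ) : ℤ), fun _ _ h => Fin.ext (Int.natCast_inj.1 h)⟩
  let y : Fin S.card ↪ ℤ := S.equivFin.symm.toEmbedding.trans (Function.Embedding.subtype _)
  have : MulAction.IsMultiplyPretransitive (Equiv.Perm ℤ) ℤ S.card :=
    Equiv.Perm.isMultiplyPretransitive ℤ _
  obtain ⟨π, hπ⟩ := MulAction.exists_smul_eq (Equiv.Perm ℤ) x y
  refine ⟨π, fun i hi => ?_⟩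
  have h1 : π (x (S.equivFin ⟨π i, hi⟩)) = π i := by
    have := DFunLike.congr_fun hπ (S.equivFin ⟨π i, hi⟩)
    simpa [y] using this
  have h2 := π.injective h1
  rw [← h2]
  have h3 := (S.equivFin ⟨π i, hi⟩).2
  exact ⟨Int.natCast_nonneg _, Int.ofNat_lt.2 (h3.trans_le hS)⟩

/-- Rearrangement of the cells `[ic, (i+1)c)` according to a permutation of `ℤ`. -/
noncomputable def cellRearrangement (c : ℝ) (π : Equiv.Perm ℤ) (ξ : ℝ) : ℝ :=
  ξ + ((π ⌊ξ / c⌋ : ℤ) - (⌊ξ / c⌋ : ℤ) : ℝ) * c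

lemma floor_cellRearrangement_div {c : ℝ} (hc : 0 < c) (π : Equiv.Perm ℤ) (ξ : ℝ) :
    ⌊cellRearrangement c π ξ / c⌋ = π ⌊ξ / c⌋ := by
  rw [cellRearrangement, add_div, mul_div_cancel_right₀ _ hc.ne', ← Int.cast_sub,
    Int.floor_add_intCast]
  ring

lemma cellRearrangement_symm {c : ℝ} (hc : 0 < c) (π : Equiv.Perm ℤ) (ξ : ℝ) :
    cellRearrangement c π.symm (cellRearrangement c π ξ) = ξ := by
  rw [cellRearrangement, floor_cellRearrangement_div hc, Equiv.symm_apply_apply,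
    cellRearrangement]
  ring

lemma bijective_cellRearrangement {c : ℝ} (hc : 0 < c) (π : Equiv.Perm ℤ) :
    Function.Bijective (cellRearrangement c π) :=
  Function.bijective_iff_has_inverse.2 ⟨cellRearrangement c π.symm,
    cellRearrangement_symm hc π, cellRearrangement_symm hc π.symm⟩

lemma measurable_cellRearrangement (c : ℝ) (π : Equiv.Perm ℤ) :
    Measurable (cellRearrangement c π) := by
  have hfl : Measurable fun ξ : ℝ => ⌊ξ / c⌋ := (measurable_id.div_const c).floor
  have h : Measurable fun i : ℤ => (((π i : ℤ) : ℝ) - (i : ℝ)) * c := Measurable.of_discrete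
  exact measurable_id.add (h.comp hfl)

lemma measurePreserving_cellRearrangement {c : ℝ} (hc : 0 < c) (π : Equiv.Perm ℤ) :
    MeasurePreserving (cellRearrangement c π) volume volume := by
  refine ⟨measurable_cellRearrangement c π, ?_⟩
  have hfl : Measurable fun ξ : ℝ => ⌊ξ / c⌋ := (measurable_id.div_const c).floor
  have hcell : ∀ i : ℤ, MeasurableSet {ξ : ℝ | ⌊ξ / c⌋ = i} := fun i =>
    hfl (measurableSet_singleton i)
  have hsplit : ∀ s : Set ℝ, MeasurableSet s →
      volume s = ∑' i : ℤ, volume (s ∩ {ξ : ℝ | ⌊ξ / c⌋ = i}) := by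
    intro s hs
    rw [← measure_iUnion _ fun i => hs.inter (hcell i)]
    · congr 1
      ext ξ
      simp
    · intro i j hij
      refine Set.disjoint_left.2 fun ξ h1 h2 => hij ?_
      rw [← h1.2, ← h2.2]
  ext s hs
  rw [Measure.map_apply (measurable_cellRearrangement c π) hs,
    hsplit _ (measurable_cellRearrangement c π hs), hsplit s hs,
    ← Equiv.tsum_eq π fun i => volume (s ∩ {ξ : ℝ | ⌊ξ / c⌋ = i})]
  refine tsum_congr fun i => ?_
  conv_rhs => rw [← measure_preimage_add_right volume (((π i : ℤ) - (i : ℤ) : ℝ) * c)]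
  congr 1
  ext ξ
  have hfloor : ⌊(ξ + ((π i : ℤ) - (i : ℤ) : ℝ) * c) / c⌋ = ⌊ξ / c⌋ + (π i - i) := by
    rw [add_div, mul_div_cancel_right₀ _ hc.ne', ← Int.cast_sub, Int.floor_add_intCast]
  simp only [Set.mem_inter_iff, Set.mem_preimage, Set.mem_ofPred_eq, hfloor]
  constructor
  · rintro ⟨h1, h2⟩
    rw [cellRearrangement, h2] at h1
    exact ⟨h1, by omega⟩
  · rintro ⟨h1, h2⟩
    have h3 : ⌊ξ / c⌋ = i := by omega
    rw [cellRearrangement, h3]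
    exact ⟨h1, rfl⟩

/-- A function living on at most `K` cells of length `c` can be rearranged to live on `[0, Kc]`. -/
lemma exists_rearrangement {c : ℝ} (hc : 0 < c) (S : Finset ℤ) {K : ℕ} (hS : S.card ≤ K) :
    ∃ σ : ℝ → ℝ, Function.Bijective σ ∧ MeasurePreserving σ volume volume ∧
      ∀ ξ, ⌊σ ξ / c⌋ ∈ S → ξ ∈ Set.Icc 0 (K * c) := by
  obtain ⟨π, hπ⟩ := exists_perm_preimage_subset_range S hS
  refine ⟨cellRearrangement c π, bijective_cellRearrangement hc π,
    measurePreserving_cellRearrangement hc π, fun ξ hξ => ?_⟩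
  rw [floor_cellRearrangement_div hc] at hξ
  obtain ⟨h1, h2⟩ := hπ _ hξ
  constructor
  · rw [Int.floor_nonneg] at h1
    by_contra hneg
    exact absurd h1 (not_le.2 (div_neg_of_neg_of_pos (not_le.1 hneg) hc))
  · rw [Int.floor_lt] at h2
    rw [div_lt_iff₀ hc] at h2
    exact_mod_cast h2.le

lemma eLpNorm_abs_rpow_mul_le {p : ℝ≥0∞} {β : ℝ} (hβ : 0 ≤ β) {g : ℝ → ℂ} {R T : ℝ}
    (hR : 0 ≤ R) (hT : 0 < T) (hsupp : ∀ ξ, g ξ ≠ 0 → ξ ∈ Set.Icc 0 T) (hg : ∀ ξ, ‖g ξ‖ ≤ R) :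
    eLpNorm (fun ξ => |ξ| ^ β * ‖g ξ‖) p volume ≤
      ENNReal.ofReal (R * T ^ (β + (1 / p).toReal)) := by
  have hpt : ∀ ξ, ‖|ξ| ^ β * ‖g ξ‖‖ ≤ (Set.Icc 0 T).indicator (fun _ => T ^ β * R) ξ := by
    intro ξ
    rw [Real.norm_of_nonneg (by positivity)]
    by_cases h : ξ ∈ Set.Icc 0 T
    · rw [Set.indicator_of_mem h, abs_of_nonneg h.1]
      exact mul_le_mul (Real.rpow_le_rpow h.1 h.2 hβ) (hg ξ) (norm_nonneg _) (by positivity)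
    · rw [Set.indicator_of_notMem h, not_imp_comm.1 (hsupp ξ) h, norm_zero, mul_zero]
  refine (eLpNorm_mono_real hpt).trans ((eLpNorm_indicator_const_le _ _).trans_eq ?_)
  rw [Real.volume_Icc, sub_zero, Real.enorm_eq_ofReal (by positivity),
    ENNReal.ofReal_rpow_of_pos hT, ← ENNReal.ofReal_mul (by positivity), Real.rpow_add hT,
    one_div p, ENNReal.toReal_inv, one_div]
  congr 1
  ring

lemma exists_schwartz_modulated_sum {ψ : ℝ → ℝ} (hψ : ContDiff ℝ (⊤ : ℕ∞) ψ)
    (hc : HasCompactSupport ψ) (s : Finset ℕ) (ν : ℕ → ℝ) {w : ℝ} (hw : 0 < w) :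
    ∃ f : SchwartzMap ℝ ℂ,
      (∀ x, f x = (∑ k ∈ s, phase (ν k * x)) * 𝓕⁻ (fun t => (ψ t : ℂ)) (w * x)) ∧
      ∀ ξ, 𝓕 (⇑f) ξ = ∑ k ∈ s, ((w⁻¹ * ψ ((ξ - ν k) / w) : ℝ) : ℂ) := by
  have hsmooth : ∀ k, ContDiff ℝ (⊤ : ℕ∞) fun ξ => ((w⁻¹ * ψ ((ξ - ν k) / w) : ℝ) : ℂ) := fun k =>
    Complex.ofRealCLM.contDiff.comp
      (contDiff_const.mul (hψ.comp ((contDiff_id.sub contDiff_const).div_const w)))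
  have hcomp : ∀ k, HasCompactSupport fun ξ => ((w⁻¹ * ψ ((ξ - ν k) / w) : ℝ) : ℂ) := by
    intro k
    let e : ℝ ≃ₜ ℝ := (Homeomorph.addRight (-ν k)).trans (Homeomorph.mulRight₀ w⁻¹ (by positivity))
    refine (hc.comp_homeomorph e).comp_left (g := fun t : ℝ => ((w⁻¹ * t : ℝ) : ℂ)) ?_
    simp
  let g : ℕ → SchwartzMap ℝ ℂ := fun k => (hcomp k).toSchwartzMap (hsmooth k)
  refine ⟨𝓕⁻ (∑ k ∈ s, g k), fun x => ?_, fun ξ => ?_⟩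
  · rw [FourierTransform.fourierInv_sum, sum_apply, Finset.sum_mul]
    refine Finset.sum_congr rfl fun k _ => ?_
    rw [SchwartzMap.fourierInv_coe, fourierInv_eq_integral_phase, fourierInv_eq_integral_phase,
      ← integral_const_mul]
    calc ∫ ξ, phase (ξ * x) * g k ξ
        = ∫ ξ, phase ((ν k + ξ) * x) * g k (ν k + ξ) :=
          (integral_add_left_eq_self (fun ξ : ℝ => phase (ξ * x) * g k ξ) (ν k)).symm
      _ = w • ∫ t, phase ((ν k + w * t) * x) * g k (ν k + w * t) := by
          rw [Measure.integral_comp_mul_left (fun ξ => phase ((ν k + ξ) * x) * g k (ν k + ξ)) w,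
            smul_smul, abs_of_pos (by positivity), mul_inv_cancel₀ hw.ne', one_smul]
      _ = ∫ t, phase (ν k * x) * (phase (t * (w * x)) * (ψ t : ℂ)) := by
          rw [← integral_smul]
          refine integral_congr_ae (.of_forall fun t => ?_)
          have hg : g k (ν k + w * t) = ((w⁻¹ * ψ t : ℝ) : ℂ) := by
            change ((w⁻¹ * ψ ((ν k + w * t - ν k) / w) : ℝ) : ℂ) = _
            rw [add_sub_cancel_left, mul_div_cancel_left₀ _ hw.ne']
          have hw' : (w : ℂ) ≠ 0 := by exact_mod_cast hw.ne'
          simp only [hg, add_mul, phase_add, Complex.real_smul]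
          rw [show w * t * x = t * (w * x) by ring]
          push_cast
          field_simp
  · rw [← SchwartzMap.fourier_coe, FourierTransform.fourier_fourierInv_eq, sum_apply]
    rfl

lemma exists_bump_profile : ∃ ψ : ℝ → ℝ, ContDiff ℝ (⊤ : ℕ∞) ψ ∧ HasCompactSupport ψ ∧
    (∀ t, ψ t ∈ Set.Icc 0 1) ∧ (∀ t, ψ t ≠ 0 → t ∈ Set.Ioo 0 1) ∧
    (∃ c > 0, ∃ r > 0, ∀ t : ℝ, |t| < r → c ≤ ‖𝓕⁻ (fun s => (ψ s : ℂ)) t‖) ∧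
    ∃ M > 0, ∀ t : ℝ, (1 + |t|) ^ 5 * ‖𝓕⁻ (fun s => (ψ s : ℂ)) t‖ ≤ M := by
  let ψ : ContDiffBump (1 / 2 : ℝ) := ⟨1 / 8, 1 / 4, by norm_num, by norm_num⟩
  have hψ : ContDiff ℝ (⊤ : ℕ∞) ψ := ψ.contDiff
  let g : SchwartzMap ℝ ℂ := (ψ.hasCompactSupport.comp_left (g := Complex.ofReal)
    Complex.ofReal_zero).toSchwartzMap (Complex.ofRealCLM.contDiff.comp hψ)
  have hg : 𝓕⁻ (fun s => (ψ s : ℂ)) = ⇑(𝓕⁻ g : SchwartzMap ℝ ℂ) :=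
    (SchwartzMap.fourierInv_coe g).symm
  refine ⟨ψ, hψ, ψ.hasCompactSupport, fun t => ⟨ψ.nonneg, ψ.le_one⟩, fun t ht => ?_, ?_, ?_⟩
  · have : t ∈ Function.support ψ := ht
    rw [ψ.support_eq, Real.ball_eq_Ioo] at this
    have h1 : ψ.rOut = 1 / 4 := rfl
    rw [h1] at this
    exact ⟨by linarith [this.1], by linarith [this.2]⟩
  · have h0 : 𝓕⁻ (fun s => (ψ s : ℂ)) 0 = ((∫ s, ψ s : ℝ) : ℂ) := by
      rw [fourierInv_eq_integral_phase, ← integral_complex_ofReal]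
      simp
    have hpos : 0 < ‖𝓕⁻ (fun s => (ψ s : ℂ)) 0‖ := by
      rw [h0, norm_pos_iff]
      exact_mod_cast ψ.integral_pos.ne'
    have hcont : Continuous fun t => ‖𝓕⁻ (fun s => (ψ s : ℂ)) t‖ := by
      rw [hg]
      exact (𝓕⁻ g).continuous.norm
    have hev := hcont.continuousAt.eventually (lt_mem_nhds (half_lt_self hpos))
    obtain ⟨r, hr, hball⟩ := Metric.eventually_nhds_iff.1 hev
    exact ⟨_, half_pos hpos, r, hr, fun t ht => (hball (by simpa using ht)).le⟩
  · have h := SchwartzMap.one_add_le_sup_seminorm_apply (𝕜 := ℝ) (m := (5, 0)) (k := 5) (n := 0)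
      le_rfl le_rfl (𝓕⁻ g)
    rw [hg]
    simp only [norm_iteratedFDeriv_zero, Real.norm_eq_abs] at h
    exact ⟨_, lt_max_of_lt_right (zero_lt_one' ℝ), fun t => (h t).trans (le_max_left _ 1)⟩

lemma le_norm_sum_phase_sq {n : ℕ} {y : ℝ} (hy : (n : ℝ) ^ 2 * |y| ≤ 1 / 64) :
    (n : ℝ) / 2 ≤ ‖∑ j ∈ Finset.range n, phase (((n + j : ℕ) : ℝ) ^ 2 * y)‖ := by
  have h1 : ‖∑ j ∈ Finset.range n, (phase (((n + j : ℕ) : ℝ) ^ 2 * y) - 1)‖ ≤ n * (1 / 2) := by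
    suffices h : ∀ j ∈ Finset.range n, ‖phase (((n + j : ℕ) : ℝ) ^ 2 * y) - 1‖ ≤ 1 / 2 by
      simpa using (norm_sum_le _ _).trans (Finset.sum_le_card_nsmul _ _ _ h)
    refine fun j hj => (norm_phase_sub_one_le _).trans ?_
    have hj' : (j : ℝ) ≤ n := by exact_mod_cast (Finset.mem_range.1 hj).le
    have h2 : ((n + j : ℕ) : ℝ) ^ 2 ≤ 4 * (n : ℝ) ^ 2 := by
      push_cast
      nlinarith [(Nat.cast_nonneg j : (0 : ℝ) ≤ j), (Nat.cast_nonneg n : (0 : ℝ) ≤ n)]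
    have h3 : |((n + j : ℕ) : ℝ) ^ 2 * y| ≤ 1 / 16 := by
      rw [abs_mul, abs_of_nonneg (by positivity)]
      nlinarith [mul_le_mul_of_nonneg_right h2 (abs_nonneg y)]
    nlinarith [Real.pi_pos, Real.pi_lt_four]
  rw [Finset.sum_sub_distrib, Finset.sum_const, Finset.card_range, nsmul_eq_mul, mul_one] at h1
  have h4 := norm_sub_norm_le (n : ℂ) (∑ j ∈ Finset.range n, phase (((n + j : ℕ) : ℝ) ^ 2 * y))
  rw [norm_sub_rev, Complex.norm_natCast] at h4
  linarith

lemma norm_sum_phase_sq_minor_arc {m : ℕ} (hm : 2 ≤ m) {y : ℝ} (hy1 : ((m : ℝ) ^ 14)⁻¹ ≤ |y|)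
    (hy2 : |y| ≤ ((m : ℝ) ^ 2)⁻¹) :
    ‖∑ j ∈ Finset.range (m ^ 8), phase (((m ^ 8 + j : ℕ) : ℝ) ^ 2 * y)‖ ≤
      64 * (m : ℝ) ^ (15 / 2 : ℝ) := by
  have hm' : (2 : ℝ) ≤ m := by exact_mod_cast hm
  have hm0 : (0 : ℝ) < m := by linarith
  have hy0 : 0 < |y| := lt_of_lt_of_le (by positivity) hy1
  have hy4 : |y| ≤ 1 / 4 := hy2.trans (by
    rw [one_div]; exact inv_anti₀ (by norm_num) (by nlinarith))
  have h := norm_sum_phase_sq_le (abs_pos.1 hy0) hy4 (Nat.one_le_pow 8 m (by omega)) (m ^ 8)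
  have hlog : 1 + Real.log ((m ^ 8 : ℕ) : ℝ) ≤ 8 * m := by
    push_cast
    rw [Real.log_pow]
    push_cast
    linarith [Real.log_le_sub_one_of_pos hm0]
  have h1 : 1 / |y| ≤ (m : ℝ) ^ 14 := by
    rw [one_div]; exact inv_le_of_inv_le₀ (by positivity) hy1
  have h2 : ((m ^ 8 : ℕ) : ℝ) ^ 2 * |y| ≤ (m : ℝ) ^ 14 := by
    push_cast
    calc ((m : ℝ) ^ 8) ^ 2 * |y| ≤ ((m : ℝ) ^ 8) ^ 2 * ((m : ℝ) ^ 2)⁻¹ := by gcongr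
      _ = (m : ℝ) ^ 14 := by field_simp
  have h3 : ((m : ℝ) ^ (15 / 2 : ℝ)) ^ 2 = (m : ℝ) ^ 15 := by
    rw [← Real.rpow_natCast, ← Real.rpow_mul hm0.le, ← Real.rpow_natCast]
    norm_num
  refine (sq_le_sq₀ (norm_nonneg _) (by positivity)).1 (h.trans ?_)
  rw [mul_pow, h3]
  calc 256 * (1 + Real.log ((m ^ 8 : ℕ) : ℝ)) * (1 / |y| + ((m ^ 8 : ℕ) : ℝ) ^ 2 * |y|)
      ≤ 256 * (8 * m) * ((m : ℝ) ^ 14 + (m : ℝ) ^ 14) := by gcongr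
    _ = 64 ^ 2 * (m : ℝ) ^ 15 := by ring

lemma eLpNorm_inv_one_add_sq_le {R w q : ℝ} (hR : 0 ≤ R) (hw : 0 < w) (hq : 1 ≤ q) :
    eLpNorm (fun x : ℝ => R * (1 + (w * x) ^ 2)⁻¹) (ENNReal.ofReal q) volume ≤
      ENNReal.ofReal (R * (w⁻¹ * Real.pi) ^ (1 / q)) := by
  have hq0 : 0 < q := by linarith
  have hint : Integrable fun x : ℝ => (1 + (w * x) ^ 2)⁻¹ :=
    integrable_inv_one_add_sq.comp_mul_left' hw.ne'
  have hval : ∫ x : ℝ, (1 + (w * x) ^ 2)⁻¹ = w⁻¹ * Real.pi := by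
    rw [Measure.integral_comp_mul_left (fun x : ℝ => (1 + x ^ 2)⁻¹) w,
      integral_univ_inv_one_add_sq, abs_of_pos (by positivity), smul_eq_mul]
  rw [eLpNorm_eq_lintegral_rpow_enorm_toReal (by simpa using hq0) ENNReal.ofReal_ne_top,
    ENNReal.toReal_ofReal hq0.le]
  have hle : ∫⁻ x : ℝ, ‖R * (1 + (w * x) ^ 2)⁻¹‖ₑ ^ q ≤
      ENNReal.ofReal (R ^ q * (w⁻¹ * Real.pi)) := by
    rw [← hval, ← integral_const_mul, ofReal_integral_eq_lintegral_ofReal (hint.const_mul _)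
      (.of_forall fun x => by positivity)]
    refine lintegral_mono fun x => ?_
    rw [Real.enorm_eq_ofReal (by positivity), ENNReal.ofReal_rpow_of_nonneg (by positivity) hq0.le,
      Real.mul_rpow hR (by positivity)]
    gcongr
    exact (Real.rpow_le_rpow_of_exponent_ge (by positivity)
      (inv_le_one_of_one_le₀ (by nlinarith [sq_nonneg (w * x)])) hq).trans_eq (Real.rpow_one _)
  refine (ENNReal.rpow_le_rpow hle (by positivity)).trans_eq ?_
  rw [ENNReal.ofReal_rpow_of_nonneg (by positivity) (by positivity),
    Real.mul_rpow (by positivity) (by positivity), ← Real.rpow_mul hR, mul_one_div_cancel hq0.ne',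
    Real.rpow_one]

lemma ofReal_mul_rpow_le_eLpNorm {f : ℝ → ℂ} {b δ q : ℝ} (hb : 0 ≤ b) (hδ : 0 < δ) (hq : 1 ≤ q)
    (hf : ∀ x, |x| ≤ δ → b ≤ ‖f x‖) :
    ENNReal.ofReal (b * (2 * δ) ^ (1 / q)) ≤ eLpNorm f (ENNReal.ofReal q) volume := by
  have hq0 : 0 < q := by linarith
  have h : eLpNorm ((Set.Icc (-δ) δ).indicator fun _ => b) (ENNReal.ofReal q) volume ≤
      eLpNorm f (ENNReal.ofReal q) volume := by
    refine eLpNorm_mono fun x => ?_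
    by_cases hx : x ∈ Set.Icc (-δ) δ
    · rw [Set.indicator_of_mem hx, Real.norm_of_nonneg hb]
      exact hf x (abs_le.2 hx)
    · rw [Set.indicator_of_notMem hx, norm_zero]
      exact norm_nonneg _
  refine le_trans (le_of_eq ?_) h
  rw [eLpNorm_indicator_const measurableSet_Icc (by simpa using hq0) ENNReal.ofReal_ne_top,
    Real.volume_Icc, Real.enorm_eq_ofReal hb, ENNReal.toReal_ofReal hq0.le,
    ENNReal.ofReal_rpow_of_pos (by linarith), ← ENNReal.ofReal_mul hb]
  congr 3
  ring

lemma exists_rearrangement_sparse_squares {ψ : ℝ → ℝ} (hψ : ∀ t, ψ t ∈ Set.Icc 0 1)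
    (hsupp : ∀ t, ψ t ≠ 0 → t ∈ Set.Ioo 0 1) {N L : ℕ} (hL : 0 < L) (hLN : L ≤ 2 * N)
    {c : ℝ} (hc : 0 < c) {F : ℝ → ℂ}
    (hF : ∀ ξ, F ξ = ∑ j ∈ Finset.range N,
      (((L * c)⁻¹ * ψ ((ξ - ((N + j : ℕ) : ℝ) ^ 2 * c) / (L * c)) : ℝ) : ℂ)) :
    (∀ ξ, ‖F ξ‖ ≤ (L * c)⁻¹) ∧ ∃ σ : ℝ → ℝ, Function.Bijective σ ∧
      MeasurePreserving σ volume volume ∧ ∀ ξ, F (σ ξ) ≠ 0 → ξ ∈ Set.Icc 0 ((N * L : ℕ) * c) := by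
  have hL' : (0 : ℝ) < L := by exact_mod_cast hL
  have hw : 0 < L * c := by positivity
  have hloc : ∀ ξ j, (((L * c)⁻¹ * ψ ((ξ - ((N + j : ℕ) : ℝ) ^ 2 * c) / (L * c)) : ℝ) : ℂ) ≠ 0 →
      (((N + j) ^ 2 : ℕ) : ℝ) < ξ / c ∧ ξ / c < (((N + j) ^ 2 + L : ℕ) : ℝ) := by
    intro ξ j h
    have h1 : ψ ((ξ - ((N + j : ℕ) : ℝ) ^ 2 * c) / (L * c)) ≠ 0 :=
      fun h0 => h (by rw [h0, mul_zero, Complex.ofReal_zero])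
    obtain ⟨h2, h3⟩ := hsupp _ h1
    rw [lt_div_iff₀ hw] at h2
    rw [div_lt_iff₀ hw] at h3
    rw [lt_div_iff₀ hc, div_lt_iff₀ hc]
    push_cast at h2 h3 ⊢
    exact ⟨by linarith, by linarith⟩
  refine ⟨fun ξ => ?_, ?_⟩
  · rw [hF]
    by_cases hex : ∃ j ∈ Finset.range N,
        (((L * c)⁻¹ * ψ ((ξ - ((N + j : ℕ) : ℝ) ^ 2 * c) / (L * c)) : ℝ) : ℂ) ≠ 0
    · obtain ⟨j, hj, hne⟩ := hex
      rw [Finset.sum_eq_single_of_mem j hj, Complex.norm_real, Real.norm_of_nonneg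
        (mul_nonneg (by positivity) (hψ _).1)]
      · exact mul_le_of_le_one_right (by positivity) (hψ _).2
      · intro i _ hij
        by_contra hi
        obtain ⟨h1, h2⟩ := hloc ξ j hne
        obtain ⟨h3, h4⟩ := hloc ξ i hi
        have h5 : (N + j) ^ 2 < (N + i) ^ 2 + L := by exact_mod_cast h1.trans h4
        have h6 : (N + i) ^ 2 < (N + j) ^ 2 + L := by exact_mod_cast h3.trans h2
        rcases lt_or_gt_of_ne hij with h | h <;> nlinarith
    · push Not at hex
      rw [Finset.sum_eq_zero hex, norm_zero]
      positivity
  · let S : Finset ℤ := (Finset.range N ×ˢ Finset.range L).image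
      fun a => (((N + a.1) ^ 2 + a.2 : ℕ) : ℤ)
    have hS : S.card ≤ N * L := by
      simpa using (Finset.card_image_le (s := Finset.range N ×ˢ Finset.range L)
        (f := fun a => (((N + a.1) ^ 2 + a.2 : ℕ) : ℤ)))
    obtain ⟨σ, hσ, hmp, hin⟩ := exists_rearrangement hc S hS
    refine ⟨σ, hσ, hmp, fun ξ hξ => hin ξ ?_⟩
    rw [hF] at hξ
    obtain ⟨j, hj, hne⟩ := Finset.exists_ne_zero_of_sum_ne_zero hξ
    obtain ⟨h1, h2⟩ := hloc _ j hne
    have h3 : (((N + j) ^ 2 : ℕ) : ℤ) ≤ ⌊σ ξ / c⌋ := Int.le_floor.2 (by exact_mod_cast h1.le)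
    have h4 : ⌊σ ξ / c⌋ < (((N + j) ^ 2 + L : ℕ) : ℤ) := Int.floor_lt.2 (by exact_mod_cast h2)
    refine Finset.mem_image.2 ⟨(j, (⌊σ ξ / c⌋ - (((N + j) ^ 2 : ℕ) : ℤ)).toNat), ?_, ?_⟩
    · rw [Finset.mem_product]
      refine ⟨hj, Finset.mem_range.2 ?_⟩
      push_cast at h3 h4 ⊢
      omega
    · push_cast at h3 ⊢
      rw [Int.toNat_of_nonneg (by linarith)]
      ring

/-- Decay of `∑ exp(2πi k² λx) · φ(m⁴ λx)`, `λ = m⁻¹³`, away from the central peak. -/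
lemma norm_modulated_sum_le {m : ℕ} (hm : 2 ≤ m) {φ : ℝ → ℂ} {M : ℝ} (hM : 0 < M)
    (hφ : ∀ t : ℝ, (1 + |t|) ^ 5 * ‖φ t‖ ≤ M) {x : ℝ} (hx : (m : ℝ)⁻¹ ≤ |x|) :
    ‖(∑ j ∈ Finset.range (m ^ 8), phase (((m ^ 8 + j : ℕ) : ℝ) ^ 2 * (((m : ℝ) ^ 13)⁻¹ * x))) *
      φ (((m : ℝ) ^ 9)⁻¹ * x)‖ ≤
      64 * M * (m : ℝ) ^ (15 / 2 : ℝ) * ((1 + |((m : ℝ) ^ 9)⁻¹ * x|) ^ 4)⁻¹ := by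
  have hm' : (2 : ℝ) ≤ m := by exact_mod_cast hm
  have hm0 : (0 : ℝ) < m := by linarith
  set t := ((m : ℝ) ^ 9)⁻¹ * x
  set y := ((m : ℝ) ^ 13)⁻¹ * x with hy
  have hyabs : |y| = ((m : ℝ) ^ 13)⁻¹ * |x| := by
    rw [hy, abs_mul, abs_of_pos (by positivity)]
  have hty : |t| = (m : ℝ) ^ 4 * |y| := by
    rw [hyabs, abs_mul, abs_of_pos (by positivity)]
    field_simp
  have hφt : ‖φ t‖ ≤ M * ((1 + |t|) ^ 5)⁻¹ := by
    rw [← div_eq_mul_inv, le_div_iff₀ (by positivity), mul_comm]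
    exact hφ t
  have hy1 : ((m : ℝ) ^ 14)⁻¹ ≤ |y| := by
    rw [hyabs]
    calc ((m : ℝ) ^ 14)⁻¹ = ((m : ℝ) ^ 13)⁻¹ * (m : ℝ)⁻¹ := by field_simp
      _ ≤ _ := by gcongr
  have ht1 : 1 ≤ 1 + |t| := by linarith [abs_nonneg t]
  have hsmall := norm_sum_phase_sq_minor_arc hm hy1
  have hD : ‖∑ j ∈ Finset.range (m ^ 8), phase (((m ^ 8 + j : ℕ) : ℝ) ^ 2 * y)‖ ≤ (m : ℝ) ^ 8 := by
    refine (norm_sum_le _ _).trans_eq ?_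
    simp only [norm_phase, Finset.sum_const, Finset.card_range, nsmul_eq_mul, mul_one,
      Nat.cast_pow]
  rw [norm_mul]
  generalize ‖∑ j ∈ Finset.range (m ^ 8), phase (((m ^ 8 + j : ℕ) : ℝ) ^ 2 * y)‖ = D at *
  rcases le_or_gt |y| ((m : ℝ) ^ 2)⁻¹ with h | h
  · calc D * ‖φ t‖ ≤ (64 * (m : ℝ) ^ (15 / 2 : ℝ)) * (M * ((1 + |t|) ^ 5)⁻¹) :=
          mul_le_mul (hsmall h) hφt (norm_nonneg _) (by positivity)
      _ ≤ (64 * (m : ℝ) ^ (15 / 2 : ℝ)) * (M * ((1 + |t|) ^ 4)⁻¹) := by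
          gcongr
          norm_num
      _ = _ := by ring
  · have ht2 : (m : ℝ) ^ 2 ≤ 1 + |t| := by
      rw [hty]
      have : (m : ℝ) ^ 2 = (m : ℝ) ^ 4 * ((m : ℝ) ^ 2)⁻¹ := by field_simp
      rw [this]
      linarith [mul_le_mul_of_nonneg_left h.le (by positivity : 0 ≤ (m : ℝ) ^ 4)]
    calc D * ‖φ t‖ ≤ (m : ℝ) ^ 8 * (M * ((1 + |t|) ^ 5)⁻¹) :=
          mul_le_mul hD hφt (norm_nonneg _) (by positivity)
      _ = M * (m : ℝ) ^ 8 * (1 + |t|)⁻¹ * ((1 + |t|) ^ 4)⁻¹ := by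
          field_simp
      _ ≤ M * (m : ℝ) ^ 8 * ((m : ℝ) ^ 2)⁻¹ * ((1 + |t|) ^ 4)⁻¹ := by
          gcongr
      _ = M * (m : ℝ) ^ (6 : ℝ) * ((1 + |t|) ^ 4)⁻¹ := by
          rw [show ((6 : ℝ)) = ((6 : ℕ) : ℝ) by norm_num, Real.rpow_natCast]
          field_simp
      _ ≤ 64 * M * (m : ℝ) ^ (15 / 2 : ℝ) * ((1 + |t|) ^ 4)⁻¹ := by
          gcongr
          · linarith
          · linarith
          · norm_num

/-- Pointwise splitting of the weighted function into central and non-central parts. -/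
lemma rpow_mul_norm_modulated_sum_le {m : ℕ} (hm : 2 ≤ m) {φ : ℝ → ℂ} {M : ℝ} (hM : 0 < M)
    (hφ : ∀ t : ℝ, (1 + |t|) ^ 5 * ‖φ t‖ ≤ M) {f : ℝ → ℂ}
    (hf : ∀ x, f x = (∑ j ∈ Finset.range (m ^ 8),
      phase (((m ^ 8 + j : ℕ) : ℝ) ^ 2 * (((m : ℝ) ^ 13)⁻¹ * x))) * φ (((m : ℝ) ^ 9)⁻¹ * x))
    {α : ℝ} (hα : 0 ≤ α) (hα1 : α ≤ 1) (x : ℝ) :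
    |x| ^ α * ‖f x‖ ≤ (m : ℝ) ^ (-α) * ‖f x‖ +
      64 * M * (m : ℝ) ^ (15 / 2 + 9 * α) * (1 + (((m : ℝ) ^ 9)⁻¹ * x) ^ 2)⁻¹ := by
  have hm0 : (0 : ℝ) < m := by exact_mod_cast (by omega : 0 < m)
  rcases le_or_gt |x| (m : ℝ)⁻¹ with h | h
  · have h1 : |x| ^ α ≤ (m : ℝ) ^ (-α) := by
      rw [Real.rpow_neg hm0.le, ← Real.inv_rpow hm0.le]
      exact Real.rpow_le_rpow (abs_nonneg x) h hα
    have := mul_le_mul_of_nonneg_right h1 (norm_nonneg (f x))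
    exact le_add_of_le_of_nonneg this (by positivity)
  · refine le_add_of_nonneg_of_le (by positivity) ?_
    have h1 := norm_modulated_sum_le hm hM hφ h.le
    rw [← hf] at h1
    set t := ((m : ℝ) ^ 9)⁻¹ * x with ht
    have hxt : |x| = (m : ℝ) ^ 9 * |t| := by
      rw [ht, abs_mul, abs_of_pos (by positivity : 0 < ((m : ℝ) ^ 9)⁻¹)]
      field_simp
    have ht1 : 1 ≤ 1 + |t| := by linarith [abs_nonneg t]
    have h2 : |x| ^ α ≤ (m : ℝ) ^ (9 * α) * (1 + |t|) := by
      rw [hxt, Real.mul_rpow (by positivity) (abs_nonneg t), Real.rpow_mul hm0.le]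
      gcongr
      · exact (Real.rpow_natCast (m : ℝ) 9).symm.le
      · calc |t| ^ α ≤ (1 + |t|) ^ α := by gcongr; linarith
          _ ≤ (1 + |t|) ^ (1 : ℝ) := Real.rpow_le_rpow_of_exponent_le ht1 hα1
          _ = 1 + |t| := Real.rpow_one _
    have h3 : (1 + |t|) * ((1 + |t|) ^ 4)⁻¹ ≤ (1 + t ^ 2)⁻¹ := by
      have h4 : 1 + t ^ 2 ≤ (1 + |t|) ^ 3 := by
        rw [← sq_abs t]
        nlinarith [abs_nonneg t, pow_nonneg (abs_nonneg t) 3]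
      calc (1 + |t|) * ((1 + |t|) ^ 4)⁻¹ = ((1 + |t|) ^ 3)⁻¹ := by field_simp
        _ ≤ _ := inv_anti₀ (by positivity) h4
    calc |x| ^ α * ‖f x‖ ≤ ((m : ℝ) ^ (9 * α) * (1 + |t|)) *
          (64 * M * (m : ℝ) ^ (15 / 2 : ℝ) * ((1 + |t|) ^ 4)⁻¹) := by gcongr
      _ = 64 * M * ((m : ℝ) ^ (15 / 2 : ℝ) * (m : ℝ) ^ (9 * α)) *
          ((1 + |t|) * ((1 + |t|) ^ 4)⁻¹) := by ring
      _ ≤ 64 * M * ((m : ℝ) ^ (15 / 2 : ℝ) * (m : ℝ) ^ (9 * α)) * (1 + t ^ 2)⁻¹ := by gcongr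
      _ = _ := by rw [← Real.rpow_add hm0]

lemma exists_rearranged_counterexample : ∃ a > 0, ∃ b > 0, ∀ m : ℕ, 2 ≤ m →
    ∃ f : SchwartzMap ℝ ℂ, ∃ σ : ℝ → ℝ, Function.Bijective σ ∧ MeasurePreserving σ volume volume ∧
      (∀ q : ℝ, 1 ≤ q → ENNReal.ofReal (a * (m : ℝ) ^ (8 - 3 / q)) ≤
        eLpNorm (⇑f) (ENNReal.ofReal q) volume) ∧
      (∀ q : ℝ, 1 ≤ q → ∀ α : ℝ, 0 ≤ α → α ≤ 1 →
        eLpNorm (fun x => |x| ^ α * ‖f x‖) (ENNReal.ofReal q) volume ≤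
          ENNReal.ofReal ((m : ℝ) ^ (-α)) * eLpNorm (⇑f) (ENNReal.ofReal q) volume +
            ENNReal.ofReal (b * (m : ℝ) ^ (15 / 2 + 9 * α + 9 / q))) ∧
      ∀ (p : ℝ≥0∞) (β : ℝ), 0 ≤ β → eLpNorm (fun ξ => |ξ| ^ β * ‖𝓕 (⇑f) (σ ξ)‖) p volume ≤
        ENNReal.ofReal ((m : ℝ) ^ (9 - (β + (1 / p).toReal))) := by
  obtain ⟨ψ, hψ, hcomp, hψ01, hsupp, ⟨c, hc, r, hr, hlow⟩, M, hM, hdecay⟩ := exists_bump_profile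
  set φ := 𝓕⁻ (fun s => (ψ s : ℂ))
  set ρ := min (1 / 64) (r / 2) with hρ
  have hρ0 : 0 < ρ := by positivity
  have hρ1 : ρ ≤ 1 / 64 := min_le_left _ _
  refine ⟨c * ρ, by positivity, 64 * M * Real.pi, by positivity, fun m hm => ?_⟩
  have hm1 : (1 : ℝ) ≤ m := by exact_mod_cast (by omega : 1 ≤ m)
  have hm0 : (0 : ℝ) < m := by linarith
  obtain ⟨f, hf, hfhat⟩ := exists_schwartz_modulated_sum hψ hcomp (Finset.range (m ^ 8))
    (fun j => ((m ^ 8 + j : ℕ) : ℝ) ^ 2 * ((m : ℝ) ^ 13)⁻¹)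
    (w := (m ^ 4 : ℕ) * ((m : ℝ) ^ 13)⁻¹) (by positivity)
  have hw : ((m ^ 4 : ℕ) : ℝ) * ((m : ℝ) ^ 13)⁻¹ = ((m : ℝ) ^ 9)⁻¹ := by
    push_cast
    field_simp
  obtain ⟨hbd, σ, hσ, hmp, hσsupp⟩ := exists_rearrangement_sparse_squares hψ01 hsupp
    (N := m ^ 8) (L := m ^ 4) (by positivity)
    ((Nat.pow_le_pow_right (by omega) (by norm_num)).trans (Nat.le_mul_of_pos_left _ two_pos))
    (c := ((m : ℝ) ^ 13)⁻¹) (by positivity) hfhat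
  simp only [hw, mul_assoc] at hf
  refine ⟨f, σ, hσ, hmp, fun q hq => ?_, fun q hq α hα hα1 => ?_, fun p β hβ => ?_⟩
  · have hq0 : 0 < q := by linarith
    have h := ofReal_mul_rpow_le_eLpNorm (f := f) (b := (m : ℝ) ^ 8 / 2 * c)
      (δ := ρ * ((m : ℝ) ^ 3)⁻¹) (by positivity) (by positivity) hq fun x hx => ?_
    · refine le_trans (ENNReal.ofReal_le_ofReal ?_) h
      have h1 : 2 * ρ ≤ (2 * ρ) ^ (1 / q) := by
        have := Real.rpow_le_rpow_of_exponent_ge (by positivity : 0 < 2 * ρ) (by linarith)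
          (show 1 / q ≤ 1 by rw [div_le_one hq0]; exact hq)
        rwa [Real.rpow_one] at this
      have h2 : (((m : ℝ) ^ 3)⁻¹) ^ (1 / q) = (m : ℝ) ^ (-(3 / q)) := by
        rw [← Real.rpow_natCast, ← Real.rpow_neg hm0.le, ← Real.rpow_mul hm0.le]
        congr 1
        push_cast
        ring
      rw [← mul_assoc, Real.mul_rpow (by positivity) (by positivity), h2, sub_eq_add_neg,
        Real.rpow_add hm0, show (8 : ℝ) = ((8 : ℕ) : ℝ) by norm_num, Real.rpow_natCast]
      calc c * ρ * ((m : ℝ) ^ 8 * (m : ℝ) ^ (-(3 / q)))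
          = (m : ℝ) ^ 8 / 2 * c * (2 * ρ * (m : ℝ) ^ (-(3 / q))) := by ring
        _ ≤ _ := by gcongr
    · rw [hf, norm_mul]
      have h3 : ((m : ℝ) ^ 16) * |((m : ℝ) ^ 13)⁻¹ * x| ≤ ρ := by
        rw [abs_mul, abs_of_pos (by positivity)]
        calc (m : ℝ) ^ 16 * (((m : ℝ) ^ 13)⁻¹ * |x|)
            ≤ (m : ℝ) ^ 16 * (((m : ℝ) ^ 13)⁻¹ * (ρ * ((m : ℝ) ^ 3)⁻¹)) := by gcongr
          _ = ρ := by field_simp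
      have h4 : |((m : ℝ) ^ 9)⁻¹ * x| < r := by
        rw [abs_mul, abs_of_pos (by positivity)]
        calc ((m : ℝ) ^ 9)⁻¹ * |x| ≤ 1 * (ρ * 1) := by
              refine mul_le_mul (inv_le_one_of_one_le₀ (one_le_pow₀ hm1)) (hx.trans ?_)
                (abs_nonneg x) zero_le_one
              gcongr
              exact inv_le_one_of_one_le₀ (one_le_pow₀ hm1)
          _ < r := by
              have := min_le_right (1 / 64) (r / 2)
              linarith
      have h5 := le_norm_sum_phase_sq (n := m ^ 8) (y := ((m : ℝ) ^ 13)⁻¹ * x) (by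
        push_cast
        rw [← pow_mul]
        exact h3.trans hρ1)
      push_cast at h5 ⊢
      exact mul_le_mul h5 (hlow _ h4) hc.le (norm_nonneg _)
  · have hmeas : AEStronglyMeasurable (fun x => (m : ℝ) ^ (-α) * ‖f x‖) volume :=
      (continuous_const.mul f.continuous.norm).aestronglyMeasurable
    have hmeas' : AEStronglyMeasurable (fun x => 64 * M * (m : ℝ) ^ (15 / 2 + 9 * α) *
        (1 + (((m : ℝ) ^ 9)⁻¹ * x) ^ 2)⁻¹) volume := by
      refine Measurable.aestronglyMeasurable ?_
      fun_prop
    have hpt : ∀ x, ‖|x| ^ α * ‖f x‖‖ ≤ (m : ℝ) ^ (-α) * ‖f x‖ +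
        64 * M * (m : ℝ) ^ (15 / 2 + 9 * α) * (1 + (((m : ℝ) ^ 9)⁻¹ * x) ^ 2)⁻¹ := fun x => by
      rw [Real.norm_of_nonneg (by positivity)]
      exact rpow_mul_norm_modulated_sum_le hm hM hdecay hf hα hα1 x
    refine (eLpNorm_mono_real hpt).trans ((eLpNorm_add_le hmeas hmeas' (by simpa using hq)).trans
      (add_le_add ?_ ((eLpNorm_inv_one_add_sq_le (by positivity) (by positivity) hq).trans
        (ENNReal.ofReal_le_ofReal ?_))))
    · rw [← Real.enorm_eq_ofReal (by positivity : 0 ≤ (m : ℝ) ^ (-α)), ← eLpNorm_norm f]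
      exact (eLpNorm_const_smul ((m : ℝ) ^ (-α)) (fun x => ‖f x‖) _ _).le
    · have h1 : Real.pi ^ (1 / q) ≤ Real.pi := by
        have := Real.rpow_le_rpow_of_exponent_le (by linarith [Real.pi_gt_three] : 1 ≤ Real.pi)
          (show 1 / q ≤ 1 by rw [div_le_one (by linarith)]; exact hq)
        rwa [Real.rpow_one] at this
      have h2 : ((m : ℝ) ^ 9) ^ (1 / q) = (m : ℝ) ^ (9 / q) := by
        rw [← Real.rpow_natCast, ← Real.rpow_mul hm0.le]
        congr 1
        push_cast
        ring
      rw [inv_inv, Real.mul_rpow (by positivity) Real.pi_pos.le, h2, Real.rpow_add hm0 _ (9 / q)]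
      calc _ ≤ 64 * M * (m : ℝ) ^ (15 / 2 + 9 * α) * ((m : ℝ) ^ (9 / q) * Real.pi) := by gcongr
        _ = _ := by ring
  · have hT : ((m ^ 8 * m ^ 4 : ℕ) : ℝ) * ((m : ℝ) ^ 13)⁻¹ = (m : ℝ)⁻¹ := by
      push_cast
      field_simp
    rw [hT] at hσsupp
    rw [hw, inv_inv] at hbd
    refine (eLpNorm_abs_rpow_mul_le hβ (by positivity) (inv_pos.2 hm0) hσsupp
      fun ξ => hbd (σ ξ)).trans_eq ?_
    rw [Real.inv_rpow hm0.le, ← Real.rpow_neg hm0.le, sub_eq_add_neg, Real.rpow_add hm0,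
      show (9 : ℝ) = ((9 : ℕ) : ℝ) by norm_num, Real.rpow_natCast]

lemma not_uniform_rearranged_uncertainty {p : ℝ≥0∞} {β : ℝ} (hβ0 : 0 ≤ β) {q α : ℝ} (hq : 64 ≤ q)
    (hβq : 3 / q < β + (1 / p).toReal - 1) (hα : 0 < α) (hα' : α ≤ 1 / 36) :
    ¬ (∃ C : ℝ, 0 < C ∧ ∀ σ : ℝ → ℝ, Function.Bijective σ →
        MeasurePreserving σ volume volume → ∀ f : SchwartzMap ℝ ℂ,
          eLpNorm (⇑f) (ENNReal.ofReal q) volume ≤ ENNReal.ofReal C *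
            (eLpNorm (fun x => |x| ^ α * ‖f x‖) (ENNReal.ofReal q) volume +
              eLpNorm (fun ξ => |ξ| ^ β * ‖𝓕 (⇑f) (σ ξ)‖) p volume)) := by
  rintro ⟨C, hC, hunc⟩
  obtain ⟨a, ha, b, hb, hcex⟩ := exists_rearranged_counterexample
  have hsmall : ∀ e : ℝ, e < 0 → ∀ A ε : ℝ, 0 < ε →
      ∀ᶠ m : ℕ in Filter.atTop, A * (m : ℝ) ^ e < ε := by
    intro e he A ε hε
    have h := ((tendsto_rpow_neg_atTop (neg_pos.2 he)).comp
      tendsto_natCast_atTop_atTop).const_mul A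
    rw [mul_zero, neg_neg] at h
    exact h.eventually (gt_mem_nhds hε)
  have h12 : 12 / q ≤ 12 / 64 := by gcongr
  obtain ⟨m, ⟨⟨h1, h2⟩, h3⟩, hm⟩ := (((hsmall (-α) (by linarith) C (1 / 2) (by norm_num)).and
    (hsmall (-1 / 2 + 9 * α + 12 / q) (by linarith) (C * b) (a / 4) (by linarith))).and
    (hsmall (1 - (β + (1 / p).toReal) + 3 / q) (by linarith) C (a / 4) (by linarith))).and
    (Filter.eventually_ge_atTop 2) |>.exists
  obtain ⟨f, σ, hσ, hmp, hlow, hA, hB⟩ := hcex m hm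
  have hm0 : (0 : ℝ) < m := by exact_mod_cast (by omega : 0 < m)
  set V := (m : ℝ) ^ (8 - 3 / q) with hV
  have hV0 : 0 < V := by positivity
  have hu : (m : ℝ) ^ (15 / 2 + 9 * α + 9 / q) = (m : ℝ) ^ (-1 / 2 + 9 * α + 12 / q) * V := by
    rw [hV, ← Real.rpow_add hm0]
    congr 1
    ring
  have hv : (m : ℝ) ^ (9 - (β + (1 / p).toReal)) =
      (m : ℝ) ^ (1 - (β + (1 / p).toReal) + 3 / q) * V := by
    rw [hV, ← Real.rpow_add hm0]
    congr 1
    ring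
  have hfin : eLpNorm (⇑f) (ENNReal.ofReal q) volume ≠ ∞ := (f.memLp _ _).2.ne
  have hl := hlow q (by linarith)
  have hmain := (hunc σ hσ hmp f).trans (mul_le_mul_right (add_le_add
    (hA q (by linarith) α hα.le (by linarith)) (hB p β hβ0)) (ENNReal.ofReal C))
  lift eLpNorm (⇑f) (ENNReal.ofReal q) volume to NNReal using hfin with E
  rw [← ENNReal.ofReal_coe_nnreal] at hl hmain
  rw [← ENNReal.ofReal_mul (by positivity), ← ENNReal.ofReal_add (by positivity) (by positivity),
    ← ENNReal.ofReal_add (by positivity) (by positivity), ← ENNReal.ofReal_mul hC.le,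
    ENNReal.ofReal_le_ofReal_iff (by positivity), hu, hv] at hmain
  rw [ENNReal.ofReal_le_ofReal_iff E.coe_nonneg] at hl
  have k1 := mul_le_mul_of_nonneg_right h1.le E.coe_nonneg
  have k2 := mul_lt_mul_of_pos_right h2 hV0
  have k3 := mul_lt_mul_of_pos_right h3 hV0
  nlinarith

/-- Theorem 5.3: for `β > 1 − 1/p`, for all sufficiently large `q` and sufficiently
small `α > 0`, the uncertainty inequality holds for the Fourier transform but fails
uniformly over the class of operators `f ↦ f̂ ∘ σ` induced by measure-preserving
bijections `σ` of `ℝ` (a class of special Hadamard operators). -/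
theorem uncertainty_fails_for_rearranged_fourier
    (p : ℝ≥0∞) (hp : 1 ≤ p) (β : ℝ) (hβ : 1 - (1/p).toReal < β) :
    ∃ q₀ : ℝ, 2 ≤ q₀ ∧ ∃ α₀ : ℝ, 0 < α₀ ∧
      ∀ q : ℝ, q₀ ≤ q → ∀ α : ℝ, 0 < α → α ≤ α₀ →
        ((∃ C : ℝ, 0 < C ∧ ∀ f : SchwartzMap ℝ ℂ,
            eLpNorm (⇑f) (ENNReal.ofReal q) volume ≤ ENNReal.ofReal C *
              (eLpNorm (fun x => |x| ^ α * ‖f x‖) (ENNReal.ofReal q) volume +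
                eLpNorm (fun ξ => |ξ| ^ β * ‖𝓕 (⇑f) ξ‖) p volume)) ∧
          ¬ (∃ C : ℝ, 0 < C ∧ ∀ σ : ℝ → ℝ, Function.Bijective σ →
              MeasurePreserving σ volume volume → ∀ f : SchwartzMap ℝ ℂ,
                eLpNorm (⇑f) (ENNReal.ofReal q) volume ≤ ENNReal.ofReal C *
                  (eLpNorm (fun x => |x| ^ α * ‖f x‖) (ENNReal.ofReal q) volume +
                    eLpNorm (fun ξ => |ξ| ^ β * ‖𝓕 (⇑f) (σ ξ)‖) p volume))) := by
  have hp1 : (1 / p).toReal ≤ 1 := by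
    rw [one_div]
    exact ENNReal.toReal_le_of_le_ofReal zero_le_one (by simpa using ENNReal.inv_le_one.2 hp)
  have hs : 0 < β + (1 / p).toReal - 1 := by linarith
  refine ⟨max 64 (4 / (β + (1 / p).toReal - 1)), le_max_of_le_left (by norm_num), 1 / 36,
    by norm_num, fun q hq α hα hα' => ?_⟩
  have hq64 : 64 ≤ q := (le_max_left _ _).trans hq
  have hβq : 3 / q < β + (1 / p).toReal - 1 := by
    have h := (le_max_right _ _).trans hq
    rw [div_le_iff₀ hs] at h
    rw [div_lt_iff₀ (by linarith)]
    linarith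
  exact ⟨exists_uncertainty_fourier hp (by linarith) hβ (by linarith) hα.le,
    not_uniform_rearranged_uncertainty (by linarith) hq64 hβq hα hα'⟩
end
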